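/- For every ε > 0 there is a constant K > 0 such that for all real numbers A, B, C, D, δ > 0 with 1 ≤ A ≤ C, 1 ≤ B ≤ C and 1 ≤ D ≤ C, the number N of quadruples of positive integers (a, b, c, d) with A < a ≤ 2A, B < b ≤ 2B, C < c ≤ 2C, D < d ≤ 2D and |√a + √b − √c − √d| ≤ δ·√C satisfies both N ≤ K·(A·B·C·D·(δ + C^{−3/2+ε}) + (A·B·C·D)^{1/2}) and N ≤ K·A·B·C·D·(δ·C² + (A·B·C·D)^{−1/2})·C^{ε}. -/

import Mathlib

/-- Divisor bound. -/
theorem aux_divisor_bound (ε : ℝ) (hε : 0 < ε) :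
    ∃ K : ℝ, 1 ≤ K ∧ ∀ n : ℕ, 1 ≤ n → (n.divisors.card : ℝ) ≤ K * (n : ℝ) ^ ε := by
  have hl2 : 0 < Real.log 2 := Real.log_pos (by norm_num)
  set K0 : ℝ := 1 + 1 / (ε * Real.log 2) with hK0
  have hK0' : 1 ≤ K0 := by
    have : 0 < 1 / (ε * Real.log 2) := by positivity
    linarith
  set P : ℕ := ⌈(2 : ℝ) ^ (1 / ε)⌉₊ with hP
  refine ⟨K0 ^ P, one_le_pow₀ hK0', ?_⟩
  intro n hn
  have hn0 : n ≠ 0 := by omega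
  have h1 : (n.divisors.card : ℝ) = ∏ p ∈ n.primeFactors, ((n.factorization p : ℝ) + 1) := by
    rw [Nat.card_divisors hn0]; push_cast; rfl
  have h2 : (n : ℝ) ^ ε = ∏ p ∈ n.primeFactors, ((p : ℝ) ^ (n.factorization p)) ^ ε := by
    rw [Real.finsetProd_rpow _ _ (fun i _ => by positivity)]
    congr 1
    have := Nat.prod_factorization_pow_eq_self hn0
    conv_lhs => rw [← this]
    rw [Finsupp.prod, Nat.support_factorization]
    push_cast
    rfl
  have h3 : ∏ p ∈ n.primeFactors, (if p < P then K0 else 1) ≤ K0 ^ P := by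
    rw [Finset.prod_ite]
    simp only [Finset.prod_const, one_pow, mul_one]
    apply pow_le_pow_right₀ hK0'
    calc (n.primeFactors.filter (fun p => p < P)).card ≤ (Finset.range P).card := by
          apply Finset.card_le_card
          intro p hp
          simp at hp ⊢
          exact hp.2
      _ = P := by simp
  rw [h1, h2]
  calc ∏ p ∈ n.primeFactors, ((n.factorization p : ℝ) + 1)
      ≤ ∏ p ∈ n.primeFactors, ((if p < P then K0 else 1) * ((p : ℝ) ^ (n.factorization p)) ^ ε) := by
        apply Finset.prod_le_prod
        · intro i _; positivity
        · intro p hp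
          have hpp : p.Prime := Nat.prime_of_mem_primeFactors hp
          have hp2 : (2 : ℝ) ≤ p := by exact_mod_cast hpp.two_le
          set v := n.factorization p
          have e1 : ((p : ℝ) ^ v) ^ ε = ((p : ℝ) ^ ε) ^ v := by
            rw [← Real.rpow_natCast, ← Real.rpow_mul (by positivity), mul_comm,
              Real.rpow_mul (by positivity), Real.rpow_natCast]
          rw [e1]
          split_ifs with h
          · have e2 : 1 + ε * Real.log 2 ≤ (p : ℝ) ^ ε := by
              calc 1 + ε * Real.log 2 ≤ Real.exp (ε * Real.log 2) := by
                    linarith [Real.add_one_le_exp (ε * Real.log 2)]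
                _ = (2 : ℝ) ^ ε := by
                    rw [Real.rpow_def_of_pos (by norm_num), mul_comm]
                _ ≤ _ := Real.rpow_le_rpow (by norm_num) hp2 hε.le
            have hx : 0 < ε * Real.log 2 := by positivity
            have e3 : 1 + v * (ε * Real.log 2) ≤ ((p : ℝ) ^ ε) ^ v := by
              calc 1 + v * (ε * Real.log 2) ≤ (1 + ε * Real.log 2) ^ v :=
                    one_add_mul_le_pow (by linarith) v
                _ ≤ _ := pow_le_pow_left₀ (by positivity) e2 v
            calc (v : ℝ) + 1 ≤ K0 * (1 + v * (ε * Real.log 2)) := by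
                  rw [hK0]
                  have : (1 + 1 / (ε * Real.log 2)) * (1 + v * (ε * Real.log 2))
                    = v + 1 + v * (ε * Real.log 2) + 1 / (ε * Real.log 2) := by
                    field_simp; ring
                  rw [this]
                  have : 0 ≤ v * (ε * Real.log 2) := by positivity
                  have : 0 < 1 / (ε * Real.log 2) := by positivity
                  linarith
              _ ≤ _ := by gcongr
          · have hpP : (2 : ℝ) ^ (1 / ε) ≤ p := by
              have : (P : ℝ) ≤ p := by exact_mod_cast not_lt.mp h
              exact (Nat.le_ceil _).trans this
            have e2 : (2 : ℝ) ≤ (p : ℝ) ^ ε := by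
              calc (2 : ℝ) = ((2 : ℝ) ^ (1 / ε)) ^ ε := by
                    rw [← Real.rpow_mul (by norm_num)]; field_simp; simp
                _ ≤ _ := Real.rpow_le_rpow (by positivity) hpP hε.le
            rw [one_mul]
            calc (v : ℝ) + 1 ≤ 2 ^ v := by
                  have := Nat.lt_two_pow_self (n := v)
                  exact_mod_cast this
              _ ≤ _ := pow_le_pow_left₀ (by positivity) e2 v
    _ = (∏ p ∈ n.primeFactors, (if p < P then K0 else 1)) *
          ∏ p ∈ n.primeFactors, ((p : ℝ) ^ (n.factorization p)) ^ ε := Finset.prod_mul_distrib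
    _ ≤ _ := by
        apply mul_le_mul_of_nonneg_right h3
        exact Finset.prod_nonneg (fun i _ => by positivity)

/-- Fiber counting with real bounds. -/
theorem aux_card_fiber {α β : Type*} [DecidableEq β] (s : Finset α) (t : Finset β) (f : α → β)
    (r : ℝ) (hf : ∀ x ∈ s, f x ∈ t)
    (hr : ∀ y ∈ t, ((s.filter (fun x => f x = y)).card : ℝ) ≤ r) :
    (s.card : ℝ) ≤ r * t.card := by
  rw [Finset.card_eq_sum_card_fiberwise (f := f) (t := t) hf]
  push_cast
  calc ∑ b ∈ t, ((s.filter (fun x => f x = b)).card : ℝ) ≤ ∑ b ∈ t, r := Finset.sum_le_sum hr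
    _ = r * t.card := by simp [mul_comm]

/-- A set of naturals with small diameter is small. -/
theorem aux_card_diam (s : Finset ℕ) (w : ℝ) (hw : 0 ≤ w)
    (h : ∀ x ∈ s, ∀ y ∈ s, (x : ℝ) - y ≤ w) : (s.card : ℝ) ≤ w + 1 := by
  rcases s.eq_empty_or_nonempty with rfl | hs
  · simp; linarith
  · have h1 : s ⊆ Finset.Icc (s.min' hs) (s.max' hs) := by
      intro x hx
      simp [Finset.min'_le _ _ hx, Finset.le_max' _ _ hx]
    have h2 := Finset.card_le_card h1
    rw [Nat.card_Icc] at h2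
    have h3 := h _ (s.max'_mem hs) _ (s.min'_mem hs)
    have h4 : s.min' hs ≤ s.max' hs := Finset.min'_le _ _ (s.max'_mem hs)
    have h5 : s.card + s.min' hs ≤ s.max' hs + 1 := by omega
    have h6 : (s.card : ℝ) + (s.min' hs : ℕ) ≤ (s.max' hs : ℕ) + 1 := by exact_mod_cast h5
    linarith

/-- Sum of nearest-integer reciprocals. -/
theorem aux_sum_min (Y W : ℝ) (hY : 1 ≤ Y) (hW : 0 ≤ W) (M : ℕ) (G : ℕ → ℝ)
    (hGW : ∀ m, G m ≤ W)
    (hG1 : ∀ m, G m * |(m : ℝ) / Y - round ((m : ℝ) / Y)| ≤ 1) :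
    ∑ m ∈ Finset.Icc 1 M, G m ≤
      4 * ((M / Y) * (W + Y * (1 + Real.log Y)) + Y * (1 + Real.log Y)) := by
  have hY0 : 0 < Y := by linarith
  set N : ℕ := ⌊(M : ℝ) / Y + 1 / 2⌋₊ with hN
  set I : ℕ := ⌊Y⌋₊ with hI
  set φ : ℕ → ℕ × ℕ × Bool := fun m =>
    ((round ((m : ℝ) / Y)).toNat, ⌊|(m : ℝ) - Y * round ((m : ℝ) / Y)|⌋₊,
      decide ((m : ℝ) < Y * round ((m : ℝ) / Y))) with hφ
  set g : ℕ × ℕ × Bool → ℝ := fun x =>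
    if x.2.1 = 0 then (if x.1 = 0 then 0 else W) else Y / x.2.1 with hg
  have hgn : ∀ x, 0 ≤ g x := by
    intro x; simp only [hg]; split_ifs <;> positivity
  have hround : ∀ m : ℕ, 0 ≤ round ((m : ℝ) / Y) := by
    intro m
    rw [round_eq]
    apply Int.floor_nonneg.mpr
    positivity
  have hroundc : ∀ m : ℕ, (((round ((m : ℝ) / Y)).toNat : ℕ) : ℝ) = (round ((m : ℝ) / Y) : ℝ) := by
    intro m
    have := Int.toNat_of_nonneg (hround m)
    exact_mod_cast this
  have habs : ∀ m : ℕ, |(m : ℝ) - Y * round ((m : ℝ) / Y)|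
      = Y * |(m : ℝ) / Y - round ((m : ℝ) / Y)| := by
    intro m
    rw [← abs_of_pos hY0, ← abs_mul, abs_of_pos hY0]
    congr 1
    field_simp
  have hGg : ∀ m ∈ Finset.Icc 1 M, G m ≤ g (φ m) := by
    intro m hm
    rw [Finset.mem_Icc] at hm
    simp only [hg, hφ]
    have hm1 : (1 : ℝ) ≤ m := by exact_mod_cast hm.1
    by_cases h0 : ⌊|(m : ℝ) - Y * round ((m : ℝ) / Y)|⌋₊ = 0
    · rw [if_pos h0]
      by_cases h1 : (round ((m : ℝ) / Y)).toNat = 0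
      · exfalso
        have h2 := hroundc m
        rw [h1] at h2
        rw [← h2] at h0
        rw [Nat.floor_eq_zero] at h0
        simp at h0
        omega
      · rw [if_neg h1]; exact hGW m
    · rw [if_neg h0]
      have h1 : (⌊|(m : ℝ) - Y * round ((m : ℝ) / Y)|⌋₊ : ℝ) ≤ |(m : ℝ) - Y * round ((m : ℝ) / Y)| :=
        Nat.floor_le (abs_nonneg _)
      have h2 : (0 : ℝ) < (⌊|(m : ℝ) - Y * round ((m : ℝ) / Y)|⌋₊ : ℝ) := by
        exact_mod_cast Nat.pos_of_ne_zero h0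
      rw [le_div_iff₀ h2]
      by_cases h3 : 0 ≤ G m
      · calc G m * _ ≤ G m * |(m : ℝ) - Y * round ((m : ℝ) / Y)| := by gcongr
          _ = Y * (G m * |(m : ℝ) / Y - round ((m : ℝ) / Y)|) := by rw [habs]; ring
          _ ≤ Y * 1 := by gcongr; exact hG1 m
          _ = Y := mul_one _
      · push Not at h3
        nlinarith
  have hinj : Set.InjOn φ (Finset.Icc 1 M : Finset ℕ) := by
    intro m _ m' _ h
    simp only [hφ, Prod.mk.injEq] at h
    obtain ⟨h1, h2, h3⟩ := h
    have e : (round ((m : ℝ) / Y) : ℝ) = round ((m' : ℝ) / Y) := by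
      rw [← hroundc m, ← hroundc m', h1]
    rw [e] at h2 h3
    set u := Y * (round ((m' : ℝ) / Y) : ℝ)
    have f1 := Nat.floor_le (abs_nonneg ((m : ℝ) - u))
    have f2 := Nat.lt_floor_add_one (|(m : ℝ) - u|)
    have f3 := Nat.floor_le (abs_nonneg ((m' : ℝ) - u))
    have f4 := Nat.lt_floor_add_one (|(m' : ℝ) - u|)
    rw [h2] at f1 f2
    have h3' : (m : ℝ) < u ↔ (m' : ℝ) < u := by simpa using h3
    generalize (⌊|(m' : ℝ) - u|⌋₊ : ℝ) = fl at f1 f2 f3 f4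
    have key : |(m : ℝ) - m'| < 1 := by
      by_cases hc : (m : ℝ) < u
      · have hc' := h3'.mp hc
        rw [abs_of_neg (by linarith : (m : ℝ) - u < 0)] at f1 f2
        rw [abs_of_neg (by linarith : (m' : ℝ) - u < 0)] at f3 f4
        rw [abs_lt]; constructor <;> linarith
      · have hc' : ¬ ((m' : ℝ) < u) := fun h => hc (h3'.mpr h)
        rw [not_lt] at hc hc'
        rw [abs_of_nonneg (by linarith : 0 ≤ (m : ℝ) - u)] at f1 f2
        rw [abs_of_nonneg (by linarith : 0 ≤ (m' : ℝ) - u)] at f3 f4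
        rw [abs_lt]; constructor <;> linarith
    have : |(m : ℤ) - m'| < 1 := by exact_mod_cast key
    rw [Int.abs_lt_one_iff] at this
    omega
  have himg : (Finset.Icc 1 M).image φ ⊆
      (Finset.range (N + 1)) ×ˢ (Finset.range (I + 1)) ×ˢ (Finset.univ : Finset Bool) := by
    intro x hx
    rw [Finset.mem_image] at hx
    obtain ⟨m, hm, rfl⟩ := hx
    rw [Finset.mem_Icc] at hm
    simp only [hφ, Finset.mem_product, Finset.mem_range, Finset.mem_univ, and_true]
    constructor
    · rw [Nat.lt_succ_iff, hN]
      apply Nat.le_floor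
      rw [hroundc, round_eq]
      refine (Int.floor_le _).trans ?_
      have : (m : ℝ) ≤ M := by exact_mod_cast hm.2
      gcongr
    · rw [Nat.lt_succ_iff, hI]
      apply Nat.floor_le_floor
      rw [habs]
      have := abs_sub_round ((m : ℝ) / Y)
      nlinarith
  have hL : 0 ≤ Real.log Y := Real.log_nonneg hY
  have hharm : ∑ i ∈ Finset.range I, Y / ((i : ℝ) + 1) ≤ Y * (1 + Real.log Y) := by
    have h1 := harmonic_le_one_add_log I
    have h2 : ((harmonic I : ℚ) : ℝ) = ∑ i ∈ Finset.range I, ((i : ℝ) + 1)⁻¹ := by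
      simp [harmonic]
    simp_rw [div_eq_mul_inv]
    rw [← Finset.mul_sum, ← h2]
    gcongr
    refine h1.trans ?_
    have hI1 : 1 ≤ I := Nat.le_floor (by simpa using hY)
    have : Real.log I ≤ Real.log Y := Real.log_le_log (by exact_mod_cast hI1) (Nat.floor_le hY0.le)
    linarith
  have hNle : (N : ℝ) ≤ 2 * (M / Y) := by
    by_cases h : N = 0
    · rw [h]; simp; positivity
    · have h1 : (1 : ℝ) ≤ N := by exact_mod_cast Nat.pos_of_ne_zero h
      have h2 : (N : ℝ) ≤ (M : ℝ) / Y + 1 / 2 := Nat.floor_le (by positivity)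
      linarith
  calc ∑ m ∈ Finset.Icc 1 M, G m ≤ ∑ m ∈ Finset.Icc 1 M, g (φ m) := Finset.sum_le_sum hGg
    _ = ∑ x ∈ (Finset.Icc 1 M).image φ, g x := (Finset.sum_image hinj).symm
    _ ≤ ∑ x ∈ (Finset.range (N + 1)) ×ˢ (Finset.range (I + 1)) ×ˢ (Finset.univ : Finset Bool), g x :=
        Finset.sum_le_sum_of_subset_of_nonneg himg (fun x _ _ => hgn x)
    _ = ∑ n ∈ Finset.range (N + 1), (2 * (if n = 0 then 0 else W) +
          2 * ∑ i ∈ Finset.range I, Y / ((i : ℝ) + 1)) := by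
        rw [Finset.sum_product]
        apply Finset.sum_congr rfl
        intro n _
        rw [Finset.sum_product, Finset.sum_range_succ', Finset.mul_sum]
        simp only [hg]
        simp
        rw [add_comm]
        congr 1
        · split_ifs <;> ring
    _ = 2 * (N * W) + 2 * ((N + 1) * ∑ i ∈ Finset.range I, Y / ((i : ℝ) + 1)) := by
        rw [Finset.sum_add_distrib, ← Finset.mul_sum, Finset.sum_range_succ']
        simp
        ring
    _ ≤ 2 * ((2 * (M / Y)) * W) + 2 * ((2 * (M / Y) + 1) * (Y * (1 + Real.log Y))) := by
        gcongr
    _ ≤ _ := by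
        have : 0 ≤ Y * (1 + Real.log Y) := by positivity
        nlinarith

/-- The additive character. -/
noncomputable def aux_e (x : ℝ) : ℂ := Complex.exp ((2 * Real.pi * x : ℝ) * Complex.I)

theorem aux_e_add (x y : ℝ) : aux_e (x + y) = aux_e x * aux_e y := by
  unfold aux_e
  rw [← Complex.exp_add]
  congr 1
  push_cast
  ring

theorem aux_e_norm (x : ℝ) : ‖aux_e x‖ = 1 := by
  unfold aux_e
  exact Complex.norm_exp_ofReal_mul_I _

theorem aux_e_conj (x : ℝ) : (starRingEnd ℂ) (aux_e x) = aux_e (-x) := by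
  unfold aux_e
  rw [← Complex.exp_conj]
  congr 1
  rw [map_mul, Complex.conj_ofReal, Complex.conj_I]
  push_cast
  ring

theorem aux_e_int (n : ℤ) : aux_e n = 1 := by
  unfold aux_e
  rw [Complex.exp_eq_one_iff]
  exact ⟨n, by push_cast; ring⟩

theorem aux_e_zero : aux_e 0 = 1 := by
  have := aux_e_int 0
  simpa using this

theorem aux_e_sub_int (x : ℝ) (n : ℤ) : aux_e (x - n) = aux_e x := by
  have : x = (x - n) + n := by ring
  conv_rhs => rw [this, aux_e_add, aux_e_int, mul_one]

theorem aux_e_nat_mul (x : ℝ) (n : ℕ) : aux_e (n * x) = aux_e x ^ n := by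
  unfold aux_e
  rw [← Complex.exp_nat_mul]
  congr 1
  push_cast
  ring

theorem aux_e_re (x : ℝ) : (aux_e x).re = Real.cos (2 * Real.pi * x) := by
  unfold aux_e
  exact Complex.exp_ofReal_mul_I_re _

/-- Geometric sums. -/
theorem aux_geom (θ : ℝ) (N : ℕ) :
    ‖∑ i ∈ Finset.range N, aux_e (θ * i)‖ * |θ - round θ| ≤ 1 := by
  set r := θ - round θ with hr
  have h1 : aux_e θ = aux_e r := by rw [hr, aux_e_sub_int]
  have h2 : ∑ i ∈ Finset.range N, aux_e (θ * i) = ∑ i ∈ Finset.range N, aux_e r ^ i := by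
    apply Finset.sum_congr rfl
    intro i _
    rw [mul_comm, aux_e_nat_mul, h1]
  have h3 : ‖(∑ i ∈ Finset.range N, aux_e r ^ i) * (aux_e r - 1)‖ ≤ 2 := by
    rw [geom_sum_mul]
    calc ‖aux_e r ^ N - 1‖ ≤ ‖aux_e r ^ N‖ + ‖(1 : ℂ)‖ := norm_sub_le _ _
      _ = 2 := by rw [norm_pow, aux_e_norm]; norm_num
  have hrabs : |r| ≤ 1 / 2 := abs_sub_round θ
  have h4 : 4 * |r| ≤ ‖aux_e r - 1‖ := by
    unfold aux_e
    rw [mul_comm _ Complex.I, Complex.norm_exp_I_mul_ofReal_sub_one]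
    rw [norm_mul, Real.norm_eq_abs, Real.norm_eq_abs, abs_two]
    have e1 : 2 * Real.pi * r / 2 = Real.pi * r := by ring
    rw [e1]
    have e2 : |Real.sin (Real.pi * r)| = Real.sin (Real.pi * |r|) := by
      rcases le_total 0 r with h | h
      · rw [abs_of_nonneg h]
        rw [abs_of_nonneg h] at hrabs
        apply abs_of_nonneg
        apply Real.sin_nonneg_of_nonneg_of_le_pi
        · positivity
        · nlinarith [Real.pi_pos]
      · rw [abs_of_nonpos h]
        rw [abs_of_nonpos h] at hrabs
        rw [← abs_neg, ← Real.sin_neg]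
        have : -(Real.pi * r) = Real.pi * (-r) := by ring
        rw [this]
        apply abs_of_nonneg
        apply Real.sin_nonneg_of_nonneg_of_le_pi
        · nlinarith [Real.pi_pos]
        · nlinarith [Real.pi_pos]
    rw [e2]
    have e3 := Real.mul_le_sin (x := Real.pi * |r|) (by positivity) (by nlinarith [Real.pi_pos])
    have e4 : 2 / Real.pi * (Real.pi * |r|) = 2 * |r| := by
      field_simp
    linarith
  rw [norm_mul] at h3
  rw [h2]
  have := norm_nonneg (∑ i ∈ Finset.range N, aux_e r ^ i)
  nlinarith

theorem aux_geom_trivial (θ : ℝ) (N : ℕ) :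
    ‖∑ i ∈ Finset.range N, aux_e (θ * i)‖ ≤ N := by
  refine (norm_sum_le _ _).trans ?_
  simp [aux_e_norm]

theorem aux_sq_norm0 (z : ℕ → ℂ) (N : ℕ) :
    ‖∑ n ∈ Finset.range N, z n‖ ^ 2 ≤
      2 * (∑ n ∈ Finset.range N, ∑ j ∈ Finset.range (n + 1),
        z n * (starRingEnd ℂ) (z (n - j))).re := by
  induction N with
  | zero => simp
  | succ N ih =>
    rw [Finset.sum_range_succ, Finset.sum_range_succ (fun n => ∑ j ∈ Finset.range (n + 1), _),
      Complex.add_re]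
    have h1 : ∑ j ∈ Finset.range (N + 1), z N * (starRingEnd ℂ) (z (N - j))
        = z N * (starRingEnd ℂ) (∑ n ∈ Finset.range N, z n) + z N * (starRingEnd ℂ) (z N) := by
      rw [← Finset.sum_range_reflect]
      rw [Finset.sum_range_succ]
      congr 1
      · rw [map_sum, Finset.mul_sum]
        apply Finset.sum_congr rfl
        intro i hi
        rw [Finset.mem_range] at hi
        congr 3
        omega
      · congr 3
        omega
    rw [h1, Complex.add_re, Complex.mul_conj]
    set w := ∑ n ∈ Finset.range N, z n
    have h2 : ‖w + z N‖ ^ 2 = ‖w‖ ^ 2 + Complex.normSq (z N)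
        + 2 * (z N * (starRingEnd ℂ) w).re := by
      rw [Complex.sq_norm, Complex.sq_norm, Complex.normSq_add]
      have : (w * (starRingEnd ℂ) (z N)).re = (z N * (starRingEnd ℂ) w).re := by
        simp; ring
      rw [this]
    have h3 := Complex.normSq_nonneg (z N)
    rw [Complex.ofReal_re]
    linarith

theorem aux_sq_norm (z : ℕ → ℂ) (N : ℕ) :
    ‖∑ n ∈ Finset.range N, z n‖ ^ 2 ≤
      2 * (∑ j ∈ Finset.range N, ∑ i ∈ Finset.range (N - j),
        z (i + j) * (starRingEnd ℂ) (z i)).re := by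
  have h := aux_sq_norm0 z N
  have h2 := Finset.sum_range_diag_flip N (fun j i => z (i + j) * (starRingEnd ℂ) (z i))
  rw [← h2]
  refine h.trans (le_of_eq ?_)
  congr 2
  apply Finset.sum_congr rfl
  intro n _
  apply Finset.sum_congr rfl
  intro j hj
  rw [Finset.mem_range] at hj
  congr 2
  omega

/-- Weyl differencing for a quadratic phase. -/
theorem aux_weyl (β γ κ : ℝ) (N : ℕ) :
    ‖∑ n ∈ Finset.range N, aux_e (β * (n : ℝ) ^ 2 + γ * n + κ)‖ ^ 2 ≤
      2 * ∑ j ∈ Finset.range N, ‖∑ i ∈ Finset.range (N - j), aux_e ((2 * β * j) * i)‖ := by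
  refine (aux_sq_norm _ N).trans ?_
  gcongr
  refine (Complex.re_le_norm _).trans ((norm_sum_le _ _).trans ?_)
  apply Finset.sum_le_sum
  intro j _
  apply le_of_eq
  have : ∀ i : ℕ, aux_e (β * ((i + j : ℕ) : ℝ) ^ 2 + γ * ((i + j : ℕ) : ℝ) + κ) *
      (starRingEnd ℂ) (aux_e (β * (i : ℝ) ^ 2 + γ * i + κ))
      = aux_e (β * (j : ℝ) ^ 2 + γ * j) * aux_e ((2 * β * j) * i) := by
    intro i
    rw [aux_e_conj, ← aux_e_add, ← aux_e_add]
    congr 1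
    push_cast
    ring
  simp_rw [this]
  rw [← Finset.mul_sum, norm_mul, aux_e_norm, one_mul]

/-- Fejer kernel counting. -/
theorem aux_fejer (s S : Finset ℕ) (hS : S ⊆ s) (x : ℕ → ℝ) (η : ℝ) (H : ℕ) (hH : 1 ≤ H)
    (hη : 8 * H * η ≤ 1) (hx : ∀ k ∈ S, ∃ c : ℤ, |x k - c| ≤ η) :
    (S.card : ℝ) * H ≤ 8 * ∑ j ∈ Finset.range H, ‖∑ k ∈ s, aux_e (j * x k)‖ := by
  have hH0 : (0 : ℝ) < H := by exact_mod_cast hH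
  have h1 : ∀ k ∈ S, (H : ℝ) ^ 2 / 4 ≤ ‖∑ h ∈ Finset.range H, aux_e (h * x k)‖ ^ 2 := by
    intro k hk
    obtain ⟨c, hc⟩ := hx k hk
    have e1 : (H : ℝ) / 2 ≤ ‖∑ h ∈ Finset.range H, aux_e (h * x k)‖ := by
      refine le_trans ?_ (Complex.re_le_norm _)
      rw [Complex.re_sum]
      calc (H : ℝ) / 2 = ∑ h ∈ Finset.range H, (1 / 2 : ℝ) := by simp; ring
        _ ≤ _ := by
          apply Finset.sum_le_sum
          intro h hh
          rw [Finset.mem_range] at hh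
          have hh' : (h : ℝ) ≤ H := by exact_mod_cast hh.le
          have e2 : aux_e (h * x k) = aux_e (h * (x k - c)) := by
            rw [← aux_e_sub_int (h * x k) (h * c)]
            congr 1
            push_cast
            ring
          rw [e2, aux_e_re]
          have e3 := Real.one_sub_sq_div_two_le_cos (x := 2 * Real.pi * (h * (x k - c)))
          have e4 : |(h : ℝ) * (x k - c)| ≤ 1 / 8 := by
            rw [abs_mul, Nat.abs_cast]
            have := abs_nonneg (x k - c)
            calc (h : ℝ) * |x k - c| ≤ H * η := by gcongr
              _ ≤ 1 / 8 := by linarith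
          have e5 : ((h : ℝ) * (x k - c)) ^ 2 ≤ 1 / 64 := by
            rw [← sq_abs]
            have := abs_nonneg ((h : ℝ) * (x k - c))
            nlinarith
          have e6 : Real.pi ^ 2 ≤ 16 := by nlinarith [Real.pi_pos, Real.pi_le_four]
          have e7 : (2 * Real.pi * (h * (x k - c))) ^ 2 ≤ 1 := by
            have : (2 * Real.pi * (h * (x k - c))) ^ 2
              = 4 * (Real.pi ^ 2 * ((h : ℝ) * (x k - c)) ^ 2) := by ring
            rw [this]
            have : Real.pi ^ 2 * ((h : ℝ) * (x k - c)) ^ 2 ≤ 16 * (1 / 64) := by gcongr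
            linarith
          linarith
    nlinarith [e1]
  have h2 : ∀ k, ‖∑ h ∈ Finset.range H, aux_e (h * x k)‖ ^ 2 ≤
      2 * (∑ j ∈ Finset.range H, ((H - j : ℕ) : ℂ) * aux_e (j * x k)).re := by
    intro k
    refine (aux_sq_norm _ H).trans (le_of_eq ?_)
    congr 2
    apply Finset.sum_congr rfl
    intro j _
    have : ∀ i : ℕ, aux_e (((i + j : ℕ) : ℝ) * x k) * (starRingEnd ℂ) (aux_e (i * x k))
        = aux_e (j * x k) := by
      intro i
      rw [aux_e_conj, ← aux_e_add]
      congr 1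
      push_cast
      ring
    simp_rw [this]
    simp
  have h3 : (S.card : ℝ) * ((H : ℝ) ^ 2 / 4) ≤
      2 * (H * ∑ j ∈ Finset.range H, ‖∑ k ∈ s, aux_e (j * x k)‖) := by
    calc (S.card : ℝ) * ((H : ℝ) ^ 2 / 4) = ∑ k ∈ S, ((H : ℝ) ^ 2 / 4) := by simp
      _ ≤ ∑ k ∈ S, ‖∑ h ∈ Finset.range H, aux_e (h * x k)‖ ^ 2 := Finset.sum_le_sum h1
      _ ≤ ∑ k ∈ s, ‖∑ h ∈ Finset.range H, aux_e (h * x k)‖ ^ 2 :=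
          Finset.sum_le_sum_of_subset_of_nonneg hS (fun _ _ _ => by positivity)
      _ ≤ ∑ k ∈ s, 2 * (∑ j ∈ Finset.range H, ((H - j : ℕ) : ℂ) * aux_e (j * x k)).re :=
          Finset.sum_le_sum (fun k _ => h2 k)
      _ = 2 * (∑ j ∈ Finset.range H, ((H - j : ℕ) : ℂ) * ∑ k ∈ s, aux_e (j * x k)).re := by
          rw [← Finset.mul_sum, ← Complex.re_sum, Finset.sum_comm]
          simp_rw [Finset.mul_sum]
      _ ≤ 2 * ∑ j ∈ Finset.range H, ‖((H - j : ℕ) : ℂ) * ∑ k ∈ s, aux_e (j * x k)‖ := by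
          gcongr
          exact (Complex.re_le_norm _).trans (norm_sum_le _ _)
      _ ≤ _ := by
          gcongr
          rw [Finset.mul_sum]
          apply Finset.sum_le_sum
          intro j _
          rw [norm_mul, Complex.norm_natCast]
          gcongr
          omega
  have h4 : (H : ℝ) * ((S.card : ℝ) * H) ≤
      H * (8 * ∑ j ∈ Finset.range H, ‖∑ k ∈ s, aux_e (j * x k)‖) := by nlinarith
  exact le_of_mul_le_mul_left h4 hH0

theorem aux_pair_sum (H N : ℕ) (G : ℕ → ℝ) (hG : ∀ m, 0 ≤ G m) (T : ℝ)
    (hT : ∀ m ∈ Finset.Icc 1 (H * N), (m.divisors.card : ℝ) ≤ T) :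
    ∑ h ∈ Finset.Icc 1 H, ∑ j ∈ Finset.Icc 1 N, G (h * j) ≤
      T * ∑ m ∈ Finset.Icc 1 (H * N), G m := by
  rw [← Finset.sum_product']
  have hmap : ∀ p ∈ Finset.Icc 1 H ×ˢ Finset.Icc 1 N, p.1 * p.2 ∈ Finset.Icc 1 (H * N) := by
    intro p hp
    simp only [Finset.mem_product, Finset.mem_Icc] at hp ⊢
    exact ⟨Nat.mul_pos hp.1.1 hp.2.1, Nat.mul_le_mul hp.1.2 hp.2.2⟩
  rw [← Finset.sum_fiberwise_of_maps_to hmap, Finset.mul_sum]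
  apply Finset.sum_le_sum
  intro m hm
  calc ∑ p ∈ (Finset.Icc 1 H ×ˢ Finset.Icc 1 N).filter (fun p => p.1 * p.2 = m), G (p.1 * p.2)
      = ∑ p ∈ (Finset.Icc 1 H ×ˢ Finset.Icc 1 N).filter (fun p => p.1 * p.2 = m), G m := by
        apply Finset.sum_congr rfl
        intro p hp
        rw [(Finset.mem_filter.mp hp).2]
    _ = ((Finset.Icc 1 H ×ˢ Finset.Icc 1 N).filter (fun p => p.1 * p.2 = m)).card * G m := by
        simp
    _ ≤ T * G m := by
        apply mul_le_mul_of_nonneg_right _ (hG m)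
        refine le_trans ?_ (hT m hm)
        have : (Nat.divisorsAntidiagonal m).card = m.divisors.card := by
          rw [← Nat.map_div_right_divisors, Finset.card_map]
        rw [← this]
        norm_cast
        apply Finset.card_le_card
        intro p hp
        rw [Finset.mem_filter] at hp
        rw [Nat.mem_divisorsAntidiagonal]
        rw [Finset.mem_Icc] at hm
        exact ⟨hp.2, by omega⟩

/-- Counting near-integer values of a quadratic polynomial. -/
theorem aux_quad_count (Y : ℝ) (hY : 1 ≤ Y) (N H : ℕ) (hH : 1 ≤ H) (T : ℝ) (hT0 : 0 ≤ T)
    (hT : ∀ m ∈ Finset.Icc 1 (H * N), (m.divisors.card : ℝ) ≤ T)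
    (γ κ η : ℝ) (S : Finset ℕ) (hS : S ⊆ Finset.range N) (hη : 8 * H * η ≤ 1)
    (hx : ∀ k ∈ S, ∃ c : ℤ, |(1 / (2 * Y)) * (k : ℝ) ^ 2 + γ * k + κ - c| ≤ η) :
    (S.card : ℝ) ≤ 8 * (N / H) +
      8 * Real.sqrt (2 * N + 8 * T * ((N : ℝ) ^ 2 / Y + N * (1 + Real.log Y)
        + Y * (1 + Real.log Y))) := by
  have hY0 : 0 < Y := by linarith
  have hH0 : (0 : ℝ) < H := by exact_mod_cast hH
  have hH1 : (1 : ℝ) ≤ H := by exact_mod_cast hH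
  have hL : 0 ≤ Real.log Y := Real.log_nonneg hY
  set x : ℕ → ℝ := fun k => (1 / (2 * Y)) * (k : ℝ) ^ 2 + γ * k + κ with hxdef
  have hF := aux_fejer (Finset.range N) S hS x η H hH hη hx
  set Sh : ℕ → ℝ := fun j => ‖∑ k ∈ Finset.range N, aux_e (j * x k)‖ with hSh
  set nn : ℕ → ℝ := fun m => |(m : ℝ) / Y - round ((m : ℝ) / Y)| with hnn
  set G : ℕ → ℝ := fun m => if nn m = 0 then (N : ℝ) else min (N : ℝ) (1 / nn m) with hG
  have hnn0 : ∀ m, 0 ≤ nn m := fun m => abs_nonneg _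
  have hG0 : ∀ m, 0 ≤ G m := by
    intro m
    simp only [hG]
    split_ifs
    · positivity
    · have := hnn0 m
      positivity
  have hGN : ∀ m, G m ≤ N := by
    intro m
    simp only [hG]
    split_ifs
    · exact le_rfl
    · exact min_le_left _ _
  have hG1 : ∀ m, G m * nn m ≤ 1 := by
    intro m
    simp only [hG]
    split_ifs with h
    · rw [h]; simp
    · have h' : 0 < nn m := lt_of_le_of_ne (hnn0 m) (Ne.symm h)
      calc min (N : ℝ) (1 / nn m) * nn m ≤ (1 / nn m) * nn m := by
            gcongr; exact min_le_right _ _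
        _ = 1 := by field_simp
  have hsum := aux_sum_min Y N hY (by positivity) (H * N) G hGN hG1
  have hgeo : ∀ h j N' : ℕ, N' ≤ N →
      ‖∑ i ∈ Finset.range N', aux_e ((2 * (h * (1 / (2 * Y))) * j) * i)‖ ≤ G (h * j) := by
    intro h j N' hN'
    have e : 2 * ((h : ℝ) * (1 / (2 * Y))) * j = ((h * j : ℕ) : ℝ) / Y := by
      push_cast; field_simp
    rw [e]
    have t1 := aux_geom_trivial (((h * j : ℕ) : ℝ) / Y) N'
    have t2 := aux_geom (((h * j : ℕ) : ℝ) / Y) N'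
    have t3 : (N' : ℝ) ≤ N := by exact_mod_cast hN'
    simp only [hG]
    split_ifs with h0
    · exact t1.trans t3
    · have h' : 0 < nn (h * j) := lt_of_le_of_ne (hnn0 _) (Ne.symm h0)
      refine le_min (t1.trans t3) ?_
      rw [le_div_iff₀ h']
      exact t2
  have hSh2 : ∀ h : ℕ, Sh h ^ 2 ≤ 2 * (N + ∑ j ∈ Finset.Icc 1 N, G (h * j)) := by
    intro h
    have e1 := aux_weyl (h * (1 / (2 * Y))) (h * γ) (h * κ) N
    have e2 : Sh h = ‖∑ n ∈ Finset.range N,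
        aux_e (h * (1 / (2 * Y)) * (n : ℝ) ^ 2 + h * γ * n + h * κ)‖ := by
      simp only [hSh]
      congr 1
      apply Finset.sum_congr rfl
      intro n _
      congr 1
      simp only [hxdef]
      ring
    rw [e2]
    refine e1.trans ?_
    gcongr
    calc ∑ j ∈ Finset.range N, ‖∑ i ∈ Finset.range (N - j), aux_e ((2 * (h * (1 / (2 * Y))) * j) * i)‖
        ≤ ∑ j ∈ Finset.range (N + 1), ‖∑ i ∈ Finset.range (N - j), aux_e ((2 * (h * (1 / (2 * Y))) * j) * i)‖ := by
          apply Finset.sum_le_sum_of_subset_of_nonneg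
          · intro j hj; simp at hj ⊢; omega
          · intros; positivity
      _ ≤ N + ∑ j ∈ Finset.Icc 1 N, G (h * j) := by
          rw [Finset.sum_range_succ', add_comm]
          apply add_le_add
          · exact (aux_geom_trivial _ _).trans (by simp)
          · rw [Finset.range_eq_Ico, Finset.sum_Ico_add' (fun j : ℕ =>
              ‖∑ i ∈ Finset.range (N - j), aux_e ((2 * (h * (1 / (2 * Y))) * (j : ℕ)) * i)‖) 0 N 1]
            have : Finset.Ico (0 + 1) (N + 1) = Finset.Icc 1 N := by
              ext j; simp only [Finset.mem_Ico, Finset.mem_Icc]; omega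
            rw [this]
            apply Finset.sum_le_sum
            intro j _
            exact hgeo h j _ (by omega)
  set Z : ℝ := 2 * N + 8 * T * ((N : ℝ) ^ 2 / Y + N * (1 + Real.log Y)
        + Y * (1 + Real.log Y)) with hZ
  have hZ0 : 0 ≤ Z := by positivity
  have hsq : ∑ h ∈ Finset.Icc 1 H, Sh h ^ 2 ≤ H * Z := by
    calc ∑ h ∈ Finset.Icc 1 H, Sh h ^ 2
        ≤ ∑ h ∈ Finset.Icc 1 H, 2 * (N + ∑ j ∈ Finset.Icc 1 N, G (h * j)) :=
          Finset.sum_le_sum (fun h _ => hSh2 h)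
      _ = 2 * (H * N) + 2 * ∑ h ∈ Finset.Icc 1 H, ∑ j ∈ Finset.Icc 1 N, G (h * j) := by
          rw [← Finset.mul_sum, Finset.sum_add_distrib]
          simp
          ring
      _ ≤ 2 * (H * N) + 2 * (T * (4 * (((H * N : ℕ) / Y) * (N + Y * (1 + Real.log Y))
            + Y * (1 + Real.log Y)))) := by
          gcongr
          refine (aux_pair_sum H N G hG0 T hT).trans ?_
          gcongr
      _ ≤ 2 * (H * N) + 2 * (T * (4 * (((H * N : ℕ) / Y) * (N + Y * (1 + Real.log Y))
            + H * (Y * (1 + Real.log Y))))) := by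
          have hw : 0 ≤ Y * (1 + Real.log Y) := by positivity
          have hw2 : Y * (1 + Real.log Y) ≤ H * (Y * (1 + Real.log Y)) := by nlinarith
          have := mul_le_mul_of_nonneg_left hw2 hT0
          linarith
      _ = H * Z := by
          rw [hZ]; push_cast; field_simp; ring
  have hcs : ∑ h ∈ Finset.Icc 1 H, Sh h ≤ H * Real.sqrt Z := by
    have e1 : (∑ h ∈ Finset.Icc 1 H, Sh h) ^ 2 ≤ H * ∑ h ∈ Finset.Icc 1 H, Sh h ^ 2 := by
      have := sq_sum_le_card_mul_sum_sq (s := Finset.Icc 1 H) (f := Sh)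
      simpa using this
    have e2 : (∑ h ∈ Finset.Icc 1 H, Sh h) ^ 2 ≤ (H * Real.sqrt Z) ^ 2 := by
      rw [mul_pow, Real.sq_sqrt hZ0]
      nlinarith
    exact le_of_sq_le_sq e2 (by positivity)
  have hall : ∑ j ∈ Finset.range H, Sh j ≤ N + H * Real.sqrt Z := by
    calc ∑ j ∈ Finset.range H, Sh j ≤ ∑ j ∈ Finset.range (H + 1), Sh j := by
          apply Finset.sum_le_sum_of_subset_of_nonneg
          · intro j hj; simp at hj ⊢; omega
          · intros; positivity
      _ ≤ N + ∑ h ∈ Finset.Icc 1 H, Sh h := by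
          rw [Finset.sum_range_succ', add_comm]
          apply add_le_add
          · simp only [hSh]
            refine (norm_sum_le _ _).trans ?_
            simp [aux_e_norm]
          · rw [Finset.range_eq_Ico, Finset.sum_Ico_add' Sh 0 H 1]
            have : Finset.Ico (0 + 1) (H + 1) = Finset.Icc 1 H := by
              ext j; simp only [Finset.mem_Ico, Finset.mem_Icc]; omega
            rw [this]
      _ ≤ _ := by gcongr
  have hfin : (S.card : ℝ) * H ≤ (8 * (N / H) + 8 * Real.sqrt Z) * H := by
    have : (8 * ((N : ℝ) / H) + 8 * Real.sqrt Z) * H = 8 * (N + H * Real.sqrt Z) := by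
      field_simp
    rw [this]
    refine hF.trans ?_
    gcongr
  exact le_of_mul_le_mul_right hfin hH0

/-- Pointwise algebra for a pair `(b, c)`, in terms of square roots. -/
theorem aux_pair_alg (q δ t β σ : ℝ) (hq : 1 ≤ q) (hδ : 0 < δ) (hδq : δ * q ^ 2 ≤ 1 / 8)
    (ht1 : 1 / 3 ≤ q * |t|) (ht2 : |t| ≤ 3 / 2 * q)
    (hβ0 : 0 ≤ β) (hβ : β ≤ 3 / 2 * q) (hσ0 : 0 ≤ σ) (hσ : σ ≤ 3 / 2 * q)
    (he : |β - σ - t| ≤ δ * q) :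
    |β ^ 2 - σ ^ 2| ≤ 5 * (q * |t|) ∧
    |(β ^ 2 - σ ^ 2 - t ^ 2) ^ 2 / (4 * t ^ 2) - σ ^ 2| ≤ 10 * (δ * q ^ 3) / |t| := by
  have hu : 0 < |t| := by
    by_contra h
    have : |t| = 0 := le_antisymm (not_lt.mp h) (abs_nonneg _)
    rw [this] at ht1
    norm_num at ht1
  have ht0 : t ≠ 0 := abs_pos.mp hu
  have hδu : δ * q ≤ 3 / 8 * |t| := by
    have h1 : q * (δ * q) ≤ q * (3 / 8 * |t|) := by nlinarith
    exact le_of_mul_le_mul_left h1 (by linarith)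
  constructor
  · have h1 : |β - σ| ≤ 11 / 8 * |t| := by
      have : β - σ = (β - σ - t) + t := by ring
      rw [this]
      refine (abs_add_le _ _).trans ?_
      linarith
    have h2 : β ^ 2 - σ ^ 2 = (β - σ) * (β + σ) := by ring
    rw [h2, abs_mul, abs_of_nonneg (by linarith : 0 ≤ β + σ)]
    calc |β - σ| * (β + σ) ≤ (11 / 8 * |t|) * (3 * q) := by gcongr; linarith
      _ ≤ 5 * (q * |t|) := by nlinarith [mul_pos hu (by linarith : 0 < q)]
  · set e := β - σ - t with hedef
    have hβe : β = σ + t + e := by rw [hedef]; ring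
    have h1 : |e * (β + σ + t)| ≤ 9 / 2 * (δ * q ^ 2) := by
      rw [abs_mul]
      have : |β + σ + t| ≤ 9 / 2 * q := by
        refine (abs_add_le _ _).trans ?_
        rw [abs_of_nonneg (by linarith : 0 ≤ β + σ)]
        linarith
      calc |e| * |β + σ + t| ≤ (δ * q) * (9 / 2 * q) := by gcongr
        _ = _ := by ring
    have h2 : |4 * t * σ + e * (β + σ + t)| ≤ 8 * (q * |t|) := by
      refine (abs_add_le _ _).trans ?_
      have : |4 * t * σ| ≤ 6 * (q * |t|) := by
        rw [abs_mul, abs_mul, abs_of_nonneg hσ0]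
        norm_num
        nlinarith
      linarith
    have h3 : (β ^ 2 - σ ^ 2 - t ^ 2) ^ 2 - 4 * t ^ 2 * σ ^ 2
        = (e * (β + σ + t)) * (4 * t * σ + e * (β + σ + t)) := by
      rw [hβe]; ring
    have h4 : |(β ^ 2 - σ ^ 2 - t ^ 2) ^ 2 - 4 * t ^ 2 * σ ^ 2| ≤ 36 * (δ * q ^ 3 * |t|) := by
      rw [h3, abs_mul]
      calc _ ≤ (9 / 2 * (δ * q ^ 2)) * (8 * (q * |t|)) := by gcongr
        _ = _ := by ring
    have h5 : (β ^ 2 - σ ^ 2 - t ^ 2) ^ 2 / (4 * t ^ 2) - σ ^ 2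
        = ((β ^ 2 - σ ^ 2 - t ^ 2) ^ 2 - 4 * t ^ 2 * σ ^ 2) / (4 * t ^ 2) := by
      field_simp
    rw [h5, abs_div, abs_of_pos (by positivity : 0 < 4 * t ^ 2), div_le_div_iff₀ (by positivity) hu]
    have h6 : t ^ 2 = |t| ^ 2 := (sq_abs t).symm
    have h7 : 0 ≤ δ * q ^ 3 * |t| := by positivity
    have h8 : 10 * (δ * q ^ 3) * (4 * t ^ 2) = 40 * (δ * q ^ 3 * |t|) * |t| := by rw [h6]; ring
    rw [h8]
    calc _ ≤ 36 * (δ * q ^ 3 * |t|) * |t| := by gcongr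
      _ ≤ _ := by nlinarith [mul_nonneg h7 hu.le]

set_option maxHeartbeats 8000000 in
/-- Counting pairs `(b, c)` with `√b - √c` close to `t`. -/
theorem aux_pair_count (ε : ℝ) (hε : 0 < ε) : ∃ K : ℝ, 0 < K ∧
    ∀ C δ t : ℝ, 1 ≤ C → 0 < δ → δ * C ≤ 1 / 8 → 1 / 3 ≤ Real.sqrt C * |t| →
      |t| ≤ 3 / 2 * Real.sqrt C → ∀ S : Finset (ℕ × ℕ),
      (∀ p ∈ S, (p.1 : ℝ) ≤ 2 * C ∧ (p.2 : ℝ) ≤ 2 * C ∧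
        |Real.sqrt p.1 - Real.sqrt p.2 - t| ≤ δ * Real.sqrt C) →
      (S.card : ℝ) ≤ K * (δ * C ^ 2 + C ^ (1 / 2 + ε)) := by
  set ε1 : ℝ := 2 * ε / 3 with hε1
  have hε1p : 0 < ε1 := by positivity
  obtain ⟨Kt, hKt1, hKt⟩ := aux_divisor_bound ε1 hε1p
  set T0 : ℝ := Kt * 3 ^ ε1 with hT0
  set L0 : ℝ := 1 + (9 / 2 : ℝ) ^ ε1 / ε1 with hL0
  have hT0' : 1 ≤ T0 := by
    have : (1 : ℝ) ≤ 3 ^ ε1 := Real.one_le_rpow (by norm_num) hε1p.le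
    rw [hT0]; nlinarith
  have hL0' : 1 ≤ L0 := by
    have : 0 ≤ (9 / 2 : ℝ) ^ ε1 / ε1 := by positivity
    rw [hL0]; linarith
  refine ⟨30000 + 8 * Real.sqrt (1800 * (T0 * L0)), by positivity, ?_⟩
  intro C δ t hC hδ hδC ht1 ht2 S hS
  have hC0 : 0 < C := by linarith
  set q : ℝ := Real.sqrt C with hq
  have hq2 : q ^ 2 = C := Real.sq_sqrt hC0.le
  have hq1 : 1 ≤ q := by rw [hq]; exact Real.one_le_sqrt.mpr hC
  have hq0 : 0 < q := by linarith
  have hqC : q ≤ C ^ (1 / 2 + ε) := by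
    rw [hq, Real.sqrt_eq_rpow]
    exact Real.rpow_le_rpow_of_exponent_le hC (by linarith)
  set u : ℝ := |t| with hu
  have hu0 : 0 < u := by
    by_contra h
    have : u = 0 := le_antisymm (not_lt.mp h) (abs_nonneg _)
    rw [this] at ht1
    norm_num at ht1
  have ht0 : t ≠ 0 := abs_pos.mp hu0
  have hut : u ^ 2 = t ^ 2 := sq_abs t
  have hsq : ∀ n : ℕ, (n : ℝ) ≤ 2 * C → Real.sqrt n ≤ 3 / 2 * q := by
    intro n hn
    apply Real.sqrt_le_iff.mpr
    constructor
    · positivity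
    · calc (n : ℝ) ≤ 2 * C := hn
        _ ≤ 9 / 4 * q ^ 2 := by rw [hq2]; linarith
        _ = _ := by ring
  have hδq : δ * q ^ 2 ≤ 1 / 8 := by rw [hq2]; exact hδC
  have halg : ∀ p ∈ S, |(p.1 : ℝ) - p.2| ≤ 5 * (q * u) ∧
      |((p.1 : ℝ) - p.2 - t ^ 2) ^ 2 / (4 * t ^ 2) - p.2| ≤ 10 * (δ * q ^ 3) / u := by
    intro p hp
    obtain ⟨h1, h2, h3⟩ := hS p hp
    have := aux_pair_alg q δ t (Real.sqrt p.1) (Real.sqrt p.2) hq1 hδ hδq ht1 ht2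
      (Real.sqrt_nonneg _) (hsq _ h1) (Real.sqrt_nonneg _) (hsq _ h2) h3
    rw [Real.sq_sqrt (Nat.cast_nonneg _), Real.sq_sqrt (Nat.cast_nonneg _)] at this
    exact this
  set K0 : ℕ := ⌈5 * (q * u)⌉₊ with hK0
  have hK0le : 5 * (q * u) ≤ K0 := Nat.le_ceil _
  have hK0lt : (K0 : ℝ) < 5 * (q * u) + 1 := Nat.ceil_lt_add_one (by positivity)
  set N : ℕ := 2 * K0 + 1 with hN
  have hNle : (N : ℝ) ≤ 19 * (q * u) := by
    rw [hN]; push_cast; linarith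
  set φ : ℕ × ℕ → ℕ := fun p => p.1 + K0 - p.2 with hφ
  have hφle : ∀ p ∈ S, p.2 ≤ p.1 + K0 := by
    intro p hp
    have h1 := (abs_le.mp (halg p hp).1).1
    have : (p.2 : ℝ) ≤ (p.1 + K0 : ℕ) := by push_cast; linarith
    exact_mod_cast this
  have hφcast : ∀ p ∈ S, (φ p : ℝ) = p.1 + K0 - p.2 := by
    intro p hp
    simp only [hφ]
    rw [Nat.cast_sub (hφle p hp)]
    push_cast
    ring
  have hφmem : ∀ p ∈ S, φ p ∈ Finset.range N := by
    intro p hp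
    have h1 := (abs_le.mp (halg p hp).1).2
    rw [Finset.mem_range]
    have h2 := hφcast p hp
    have : (φ p : ℝ) < N := by rw [h2, hN]; push_cast; linarith
    exact_mod_cast this
  set x : ℕ → ℝ := fun n => ((n : ℝ) - K0 - t ^ 2) ^ 2 / (4 * t ^ 2) with hx
  set η1 : ℝ := 10 * (δ * q ^ 3) / u with hη1
  have hη1p : 0 < η1 := by positivity
  have hxp : ∀ p ∈ S, |x (φ p) - p.2| ≤ η1 := by
    intro p hp
    have h1 := (halg p hp).2
    simp only [hx]
    rw [hφcast p hp]
    have : (p.1 : ℝ) + K0 - p.2 - K0 - t ^ 2 = p.1 - p.2 - t ^ 2 := by ring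
    rw [this]
    exact h1
  have hfib : ∀ n ∈ Finset.range N, ((S.filter (fun p => φ p = n)).card : ℝ) ≤ 2 * η1 + 1 := by
    intro n _
    have hinj : Set.InjOn (Prod.snd : ℕ × ℕ → ℕ) (S.filter (fun p => φ p = n) : Finset (ℕ × ℕ)) := by
      intro p hp p' hp' h
      rw [Finset.mem_coe, Finset.mem_filter] at hp hp'
      have e1 := hφle p hp.1
      have e2 := hφle p' hp'.1
      have e3 := hp.2
      have e4 := hp'.2
      simp only [hφ] at e3 e4
      ext
      · omega
      · exact h
    rw [← Finset.card_image_of_injOn hinj]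
    apply aux_card_diam _ _ (by positivity)
    intro c hc c' hc'
    rw [Finset.mem_image] at hc hc'
    obtain ⟨p, hp, rfl⟩ := hc
    obtain ⟨p', hp', rfl⟩ := hc'
    rw [Finset.mem_filter] at hp hp'
    have e1 := hxp p hp.1
    have e2 := hxp p' hp'.1
    rw [hp.2] at e1
    rw [hp'.2] at e2
    have e3 := abs_le.mp e1
    have e4 := abs_le.mp e2
    linarith [e3.1, e4.2]
  have htriv : (S.card : ℝ) ≤ (2 * η1 + 1) * N := by
    have := aux_card_fiber S (Finset.range N) φ (2 * η1 + 1) hφmem hfib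
    simpa using this
  have hq4 : q ^ 4 = C ^ 2 := by rw [← hq2]; ring
  have hsqrt0 : 0 ≤ 8 * Real.sqrt (1800 * (T0 * L0)) := by positivity
  have hB0 : 0 ≤ δ * C ^ 2 + C ^ (1 / 2 + ε) := by positivity
  set η : ℝ := 10 * (δ * q ^ 3 + 1) / u with hη
  have hηp : 0 < η := by positivity
  by_cases hcase : 1 < 8 * η
  · -- trivial range
    have hu80 : u ≤ 80 * (δ * q ^ 3 + 1) := by
      have : u * 1 ≤ u * (8 * η) := by gcongr
      have e : u * (8 * η) = 80 * (δ * q ^ 3 + 1) := by rw [hη]; field_simp; norm_num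
      linarith
    have h1 : (S.card : ℝ) ≤ 30000 * (δ * q ^ 4 + q) := by
      calc (S.card : ℝ) ≤ (2 * η1 + 1) * N := htriv
        _ ≤ (2 * η1 + 1) * (19 * (q * u)) := by gcongr
        _ = 380 * (δ * q ^ 4) + 19 * (q * u) := by rw [hη1]; field_simp; ring
        _ ≤ 380 * (δ * q ^ 4) + 19 * (q * (80 * (δ * q ^ 3 + 1))) := by gcongr
        _ = 1900 * (δ * q ^ 4) + 1520 * q := by ring
        _ ≤ _ := by
          have : 0 ≤ δ * q ^ 4 := by positivity
          linarith
    rw [hq4] at h1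
    calc (S.card : ℝ) ≤ 30000 * (δ * C ^ 2 + q) := h1
      _ ≤ 30000 * (δ * C ^ 2 + C ^ (1 / 2 + ε)) := by gcongr
      _ ≤ _ := by gcongr; linarith
  · push Not at hcase
    have h16 : 1 ≤ 1 / (8 * η) := by
      rw [le_div_iff₀ (by positivity)]; linarith
    set H : ℕ := ⌊1 / (8 * η)⌋₊ with hH
    have hH1 : 1 ≤ H := Nat.le_floor (by simpa using h16)
    have hH1' : (1 : ℝ) ≤ H := by exact_mod_cast hH1
    have hHle : (H : ℝ) ≤ 1 / (8 * η) := Nat.floor_le (by positivity)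
    have hHge : 1 / (8 * η) < H + 1 := Nat.lt_floor_add_one _
    have hHη : 8 * H * η ≤ 1 := by
      rw [le_div_iff₀ (by positivity)] at hHle
      linarith
    have hinvH : 1 / (H : ℝ) ≤ 16 * η := by
      rw [div_le_iff₀ (by linarith)]
      rw [div_lt_iff₀ (by positivity)] at hHge
      have : η * 1 ≤ η * H := by gcongr
      linarith
    have hη10 : η1 ≤ η := by
      rw [hη, hη1]
      gcongr
      linarith
    have hu80 : 80 ≤ u := by
      have e : u * (8 * η) = 80 * (δ * q ^ 3 + 1) := by rw [hη]; field_simp; norm_num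
      have e2 : u * (8 * η) ≤ u * 1 := by gcongr
      have : 0 < δ * q ^ 3 := by positivity
      linarith
    have hHu : 80 * (H : ℝ) ≤ u := by
      have e : η * u = 10 * (δ * q ^ 3 + 1) := by rw [hη]; field_simp
      have : 0 < δ * q ^ 3 := by positivity
      have e2 : (8 * H * η) * u ≤ 1 * u := by gcongr
      have e3 : (8 * H * η) * u = 80 * H * (δ * q ^ 3 + 1) := by
        calc (8 * H * η) * u = 8 * H * (η * u) := by ring
          _ = _ := by rw [e]; ring
      have a : 80 * (H : ℝ) * 1 ≤ 80 * H * (δ * q ^ 3 + 1) := by gcongr; linarith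
      linarith
    -- the image has the same cardinality
    have hinj : Set.InjOn φ S := by
      intro p hp p' hp' h
      have e1 := abs_le.mp (hxp p hp)
      have e2 := abs_le.mp (hxp p' hp')
      rw [h] at e1
      have e3 : |((p.2 : ℤ) : ℝ) - (p'.2 : ℤ)| < 1 := by
        rw [abs_lt]
        push_cast
        constructor <;> linarith [e1.1, e1.2, e2.1, e2.2]
      have e4 : |(p.2 : ℤ) - (p'.2 : ℤ)| < 1 := by exact_mod_cast e3
      rw [Int.abs_lt_one_iff] at e4
      have e5 := hφle p hp
      have e6 := hφle p' hp'
      simp only [hφ] at h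
      ext <;> omega
    have hYdef : (1 : ℝ) ≤ 2 * t ^ 2 := by
      have : (1 : ℝ) ≤ u ^ 2 := one_le_pow₀ (by linarith)
      rw [← hut]; linarith
    have hHN : ((H * N : ℕ) : ℝ) ≤ 3 * C ^ 2 := by
      push_cast
      calc (H : ℝ) * N ≤ (u / 80) * (19 * (q * u)) := by
            gcongr
            linarith
        _ = 19 / 80 * (q * u ^ 2) := by ring
        _ ≤ q * u ^ 2 := by linarith [mul_pos hq0 (pow_pos hu0 2)]
        _ ≤ q * (3 / 2 * q) ^ 2 := by gcongr
        _ = 9 / 4 * q ^ 3 := by ring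
        _ ≤ 3 * q ^ 4 := by
            have : q ^ 3 ≤ q ^ 4 := pow_le_pow_right₀ hq1 (by norm_num)
            have : 0 < q ^ 3 := by positivity
            linarith
        _ = 3 * C ^ 2 := by rw [hq4]
    set c1 : ℝ := C ^ ε1 with hc1
    have hc11 : 1 ≤ c1 := Real.one_le_rpow hC hε1p.le
    set T : ℝ := T0 * c1 ^ 2 with hT
    have hTdiv : ∀ m ∈ Finset.Icc 1 (H * N), (m.divisors.card : ℝ) ≤ T := by
      intro m hm
      rw [Finset.mem_Icc] at hm
      refine (hKt m hm.1).trans ?_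
      have hm2 : (m : ℝ) ≤ 3 * C ^ 2 := le_trans (by exact_mod_cast hm.2) hHN
      calc Kt * (m : ℝ) ^ ε1 ≤ Kt * (3 * C ^ 2) ^ ε1 := by gcongr
        _ = T := by
          rw [hT, hT0, hc1, Real.mul_rpow (by norm_num) (by positivity), mul_assoc]
          congr 2
          rw [← Real.rpow_natCast, ← Real.rpow_natCast, ← Real.rpow_mul hC0.le,
            ← Real.rpow_mul hC0.le, mul_comm]
    have hquad := aux_quad_count (2 * t ^ 2) hYdef N H hH1 T (by positivity) hTdiv
      (-(K0 + t ^ 2) / (2 * t ^ 2)) ((K0 + t ^ 2) ^ 2 / (4 * t ^ 2)) η (S.image φ)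
      (by
        intro n hn
        rw [Finset.mem_image] at hn
        obtain ⟨p, hp, rfl⟩ := hn
        exact hφmem p hp) hHη
      (by
        intro n hn
        rw [Finset.mem_image] at hn
        obtain ⟨p, hp, rfl⟩ := hn
        refine ⟨(p.2 : ℤ), ?_⟩
        refine le_trans (le_of_eq ?_) ((hxp p hp).trans hη10)
        congr 1
        simp only [hx]
        push_cast
        field_simp
        ring)
    rw [Finset.card_image_of_injOn hinj] at hquad
    set L : ℝ := 1 + Real.log (2 * t ^ 2) with hL
    have hu2 : u ^ 2 ≤ 9 / 4 * C := by
      calc u ^ 2 ≤ (3 / 2 * q) ^ 2 := by gcongr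
        _ = 9 / 4 * C := by rw [← hq2]; ring
    have hLle : L ≤ L0 * c1 := by
      have e1 : 2 * t ^ 2 ≤ 9 / 2 * C := by rw [← hut]; linarith
      have e2 : Real.log (2 * t ^ 2) ≤ Real.log (9 / 2 * C) :=
        Real.log_le_log (by linarith) e1
      have e3 : Real.log (9 / 2 * C) ≤ (9 / 2 * C) ^ ε1 / ε1 :=
        Real.log_le_rpow_div (by positivity) hε1p
      rw [Real.mul_rpow (by norm_num) hC0.le] at e3
      have e4 : L0 * c1 = c1 + (9 / 2 : ℝ) ^ ε1 * c1 / ε1 := by rw [hL0]; ring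
      rw [e4, hL]
      linarith
    have hL0n : 0 ≤ L := by
      have := Real.log_nonneg hYdef
      rw [hL]; linarith
    have hquC : q * u ≤ 3 / 2 * C := by
      calc q * u ≤ q * (3 / 2 * q) := by gcongr
        _ = 3 / 2 * q ^ 2 := by ring
        _ = _ := by rw [hq2]
    have hNC : (N : ℝ) ≤ 57 / 2 * C := by linarith
    have hN2 : (N : ℝ) ^ 2 / (2 * t ^ 2) ≤ 181 * C := by
      rw [div_le_iff₀ (by linarith), ← hut, ← hq2]
      have : (N : ℝ) ^ 2 ≤ (19 * (q * u)) ^ 2 := by gcongr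
      linarith [mul_pos (pow_pos hq0 2) (pow_pos hu0 2)]
    have hZ : 2 * (N : ℝ) + 8 * T * ((N : ℝ) ^ 2 / (2 * t ^ 2) + N * L + 2 * t ^ 2 * L)
        ≤ (1800 * (T0 * L0)) * (C * c1 ^ 3) := by
      have hT1 : 1 ≤ T0 * c1 ^ 2 := by
        have : 1 ≤ c1 ^ 2 := one_le_pow₀ hc11
        exact one_le_mul_of_one_le_of_one_le hT0' this
      have hL1 : 1 ≤ L0 * c1 := one_le_mul_of_one_le_of_one_le hL0' hc11
      have hY2 : 2 * t ^ 2 ≤ 9 / 2 * C := by rw [← hut]; linarith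
      have hTL : 1 ≤ (T0 * c1 ^ 2) * (L0 * c1) :=
        one_le_mul_of_one_le_of_one_le hT1 hL1
      calc 2 * (N : ℝ) + 8 * T * ((N : ℝ) ^ 2 / (2 * t ^ 2) + N * L + 2 * t ^ 2 * L)
          ≤ 2 * (57 / 2 * C) + 8 * (T0 * c1 ^ 2) *
            (181 * C + 57 / 2 * C * (L0 * c1) + 9 / 2 * C * (L0 * c1)) := by
              rw [hT]; gcongr
        _ ≤ (57 * C) * ((T0 * c1 ^ 2) * (L0 * c1)) + 8 * (T0 * c1 ^ 2) *
            (181 * C * (L0 * c1) + 57 / 2 * C * (L0 * c1) + 9 / 2 * C * (L0 * c1)) := by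
              have a1 : 2 * (57 / 2 * C) ≤ (57 * C) * ((T0 * c1 ^ 2) * (L0 * c1)) := by
                calc 2 * (57 / 2 * C) = (57 * C) * 1 := by ring
                  _ ≤ _ := by gcongr
              have a2 : 181 * C ≤ 181 * C * (L0 * c1) :=
                le_mul_of_one_le_right (by positivity) hL1
              gcongr
        _ = (1769 * (T0 * L0)) * (C * c1 ^ 3) := by ring
        _ ≤ _ := by gcongr; norm_num
    have hroot : Real.sqrt (C * c1 ^ 3) = C ^ (1 / 2 + ε) := by
      have : C * c1 ^ 3 = (C ^ (1 / 2 + ε)) ^ 2 := by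
        rw [hc1, ← Real.rpow_natCast, ← Real.rpow_natCast, ← Real.rpow_mul hC0.le,
          ← Real.rpow_mul hC0.le]
        nth_rewrite 1 [← Real.rpow_one C]
        rw [← Real.rpow_add hC0]
        congr 1
        rw [hε1]
        push_cast
        ring
      rw [this, Real.sqrt_sq (by positivity)]
    have hs2 : Real.sqrt (2 * (N : ℝ) + 8 * T * ((N : ℝ) ^ 2 / (2 * t ^ 2) + N * L + 2 * t ^ 2 * L))
        ≤ Real.sqrt (1800 * (T0 * L0)) * C ^ (1 / 2 + ε) := by
      refine (Real.sqrt_le_sqrt hZ).trans (le_of_eq ?_)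
      rw [Real.sqrt_mul (by positivity), hroot]
    have hNH : (N : ℝ) / H ≤ 3040 * (δ * C ^ 2 + q) := by
      calc (N : ℝ) / H = N * (1 / H) := by ring
        _ ≤ (19 * (q * u)) * (16 * η) := by gcongr
        _ = 3040 * (δ * q ^ 4 + q) := by rw [hη]; field_simp; ring
        _ = _ := by rw [hq4]
    have hp0 : 0 ≤ δ * C ^ 2 := by positivity
    have hp1 : 0 ≤ C ^ (1 / 2 + ε) := by positivity
    have hp2 : 0 ≤ Real.sqrt (1800 * (T0 * L0)) * (δ * C ^ 2) := by positivity
    calc (S.card : ℝ) ≤ 8 * (3040 * (δ * C ^ 2 + q)) +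
          8 * (Real.sqrt (1800 * (T0 * L0)) * C ^ (1 / 2 + ε)) := by
          refine hquad.trans ?_
          gcongr
      _ ≤ _ := by linarith

/-- Triples bounded by positive reals. -/
theorem aux_first_large (A B C D δ : ℝ) (hδ : 0 < δ) (hA : 1 ≤ A) (hB : 1 ≤ B) (hC : 1 ≤ C)
    (hD : 1 ≤ D) (hδC : 1 / 8 < δ * C) (F : Finset (ℕ × ℕ × ℕ × ℕ))
    (hF : ∀ t ∈ F, (t.1 : ℝ) ≤ 2 * A ∧ (t.2.1 : ℝ) ≤ 2 * B ∧ (t.2.2.1 : ℝ) ≤ 2 * C ∧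
      (t.2.2.2 : ℝ) ≤ 2 * D ∧ 1 ≤ t.1 ∧ 1 ≤ t.2.1 ∧ 1 ≤ t.2.2.2 ∧
      |Real.sqrt t.1 + Real.sqrt t.2.1 - Real.sqrt t.2.2.1 - Real.sqrt t.2.2.2| ≤
        δ * Real.sqrt C) :
    (F.card : ℝ) ≤ 112 * (A * B * C * D * δ) := by
  have hC0 : 0 < C := by linarith
  set q : ℝ := Real.sqrt C with hq
  have hq2 : q ^ 2 = C := Real.sq_sqrt hC0.le
  have hq0 : 0 < q := Real.sqrt_pos.mpr hC0
  set t : Finset (ℕ × ℕ × ℕ) :=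
    Finset.Icc 1 ⌊2 * A⌋₊ ×ˢ Finset.Icc 1 ⌊2 * B⌋₊ ×ˢ Finset.Icc 1 ⌊2 * D⌋₊ with ht
  have htc : (t.card : ℝ) ≤ 8 * (A * B * D) := by
    rw [ht, Finset.card_product, Finset.card_product]
    simp only [Nat.card_Icc, Nat.add_sub_cancel]
    push_cast
    have h1 : (⌊2 * A⌋₊ : ℝ) ≤ 2 * A := Nat.floor_le (by linarith)
    have h2 : (⌊2 * B⌋₊ : ℝ) ≤ 2 * B := Nat.floor_le (by linarith)
    have h3 : (⌊2 * D⌋₊ : ℝ) ≤ 2 * D := Nat.floor_le (by linarith)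
    calc (⌊2 * A⌋₊ : ℝ) * (⌊2 * B⌋₊ * ⌊2 * D⌋₊) ≤ (2 * A) * ((2 * B) * (2 * D)) := by gcongr
      _ = _ := by ring
  have hcard := aux_card_fiber F t (fun x => (x.1, x.2.1, x.2.2.2)) (14 * (δ * C))
    (by
      intro x hx
      obtain ⟨h1, h2, h3, h4, h5, h6, h7, h8⟩ := hF x hx
      simp only [ht, Finset.mem_product, Finset.mem_Icc]
      exact ⟨⟨h5, Nat.le_floor h1⟩, ⟨h6, Nat.le_floor h2⟩, ⟨h7, Nat.le_floor h4⟩⟩)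
    (by
      intro y _
      have hinj : Set.InjOn (fun x : ℕ × ℕ × ℕ × ℕ => x.2.2.1)
          (F.filter (fun x => (x.1, x.2.1, x.2.2.2) = y) : Finset (ℕ × ℕ × ℕ × ℕ)) := by
        intro p hp p' hp' h
        rw [Finset.mem_coe, Finset.mem_filter] at hp hp'
        have e := hp.2.trans hp'.2.symm
        simp only [Prod.mk.injEq] at e h
        obtain ⟨p1, p2, p3, p4⟩ := p
        obtain ⟨r1, r2, r3, r4⟩ := p'
        simp only [Prod.mk.injEq] at *
        exact ⟨e.1, e.2.1, h, e.2.2⟩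
      rw [← Finset.card_image_of_injOn hinj]
      have hd := aux_card_diam ((F.filter (fun x => (x.1, x.2.1, x.2.2.2) = y)).image
        (fun x : ℕ × ℕ × ℕ × ℕ => x.2.2.1)) (6 * (δ * C)) (by positivity) (by
        intro c hc c' hc'
        rw [Finset.mem_image] at hc hc'
        obtain ⟨p, hp, rfl⟩ := hc
        obtain ⟨p', hp', rfl⟩ := hc'
        rw [Finset.mem_filter] at hp hp'
        have e := hp.2.trans hp'.2.symm
        simp only [Prod.mk.injEq] at e
        obtain ⟨-, -, g3, -, -, -, -, g8⟩ := hF p hp.1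
        obtain ⟨-, -, g3', -, -, -, -, g8'⟩ := hF p' hp'.1
        rw [e.1, e.2.1, e.2.2] at g8
        rw [abs_le] at g8 g8'
        set β := Real.sqrt p.2.2.1 with hβ
        set γ := Real.sqrt p'.2.2.1 with hγ
        have b2 : β ^ 2 = p.2.2.1 := Real.sq_sqrt (Nat.cast_nonneg _)
        have c2 : γ ^ 2 = p'.2.2.1 := Real.sq_sqrt (Nat.cast_nonneg _)
        have b0 : 0 ≤ β := Real.sqrt_nonneg _
        have c0 : 0 ≤ γ := Real.sqrt_nonneg _
        have b3 : β ≤ 3 / 2 * q := by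
          apply Real.sqrt_le_iff.mpr
          constructor
          · positivity
          · nlinarith
        have c3 : γ ≤ 3 / 2 * q := by
          apply Real.sqrt_le_iff.mpr
          constructor
          · positivity
          · nlinarith
        have hbc : β - γ ≤ 2 * (δ * q) := by linarith [g8.1, g8'.2]
        rw [← b2, ← c2, ← hq2]
        calc β ^ 2 - γ ^ 2 = (β - γ) * (β + γ) := by ring
          _ ≤ (2 * (δ * q)) * (β + γ) := by gcongr
          _ ≤ (2 * (δ * q)) * (3 * q) := by gcongr; linarith
          _ = _ := by ring)
      linarith)
  calc (F.card : ℝ) ≤ 14 * (δ * C) * t.card := hcard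
    _ ≤ 14 * (δ * C) * (8 * (A * B * D)) := by gcongr
    _ = _ := by ring

theorem aux_first_diag (A B C D δ : ℝ) (hδ : 0 < δ) (hA : 1 ≤ A) (hB : 1 ≤ B) (hC : 1 ≤ C)
    (hD : 1 ≤ D) (hδC : δ * C ≤ 1 / 8) (F : Finset (ℕ × ℕ × ℕ × ℕ))
    (hF : ∀ t ∈ F, (t.1 : ℝ) ≤ 2 * A ∧ (t.2.1 : ℝ) ≤ 2 * B ∧ (t.2.2.1 : ℝ) ≤ 2 * C ∧
      (t.2.2.2 : ℝ) ≤ 2 * D ∧ 1 ≤ t.1 ∧ 1 ≤ t.2.1 ∧ t.1 = t.2.2.2 ∧ B ≤ C ∧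
      |Real.sqrt t.1 + Real.sqrt t.2.1 - Real.sqrt t.2.2.1 - Real.sqrt t.2.2.2| ≤
        δ * Real.sqrt C) :
    (F.card : ℝ) ≤ 4 * Real.sqrt (A * B * C * D) := by
  have hC0 : 0 < C := by linarith
  set q : ℝ := Real.sqrt C with hq
  have hq2 : q ^ 2 = C := Real.sq_sqrt hC0.le
  have hq0 : 0 < q := Real.sqrt_pos.mpr hC0
  have hsq : ∀ n : ℕ, (n : ℝ) ≤ 2 * C → Real.sqrt n ≤ 3 / 2 * q := by
    intro n hn
    apply Real.sqrt_le_iff.mpr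
    constructor
    · positivity
    · calc (n : ℝ) ≤ 2 * C := hn
        _ ≤ 9 / 4 * q ^ 2 := by rw [hq2]; linarith
        _ = _ := by ring
  have hbc : ∀ t ∈ F, t.2.1 = t.2.2.1 := by
    intro t ht
    obtain ⟨h1, h2, h3, h4, h5, h6, h7, h8, h9⟩ := hF t ht
    rw [h7] at h9
    have hβ := hsq t.2.1 (by linarith)
    have hγ := hsq t.2.2.1 h3
    have b2 : Real.sqrt t.2.1 ^ 2 = t.2.1 := Real.sq_sqrt (Nat.cast_nonneg _)
    have c2 : Real.sqrt t.2.2.1 ^ 2 = t.2.2.1 := Real.sq_sqrt (Nat.cast_nonneg _)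
    have b0 : 0 ≤ Real.sqrt t.2.1 := Real.sqrt_nonneg _
    have c0 : 0 ≤ Real.sqrt t.2.2.1 := Real.sqrt_nonneg _
    have e : |Real.sqrt t.2.1 - Real.sqrt t.2.2.1| ≤ δ * q := by
      refine le_trans (le_of_eq ?_) h9
      congr 1
      ring
    have e3 : |((t.2.1 : ℤ) : ℝ) - (t.2.2.1 : ℤ)| < 1 := by
      push_cast
      rw [← b2, ← c2]
      have : Real.sqrt t.2.1 ^ 2 - Real.sqrt t.2.2.1 ^ 2
        = (Real.sqrt t.2.1 - Real.sqrt t.2.2.1) * (Real.sqrt t.2.1 + Real.sqrt t.2.2.1) := by ring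
      rw [this, abs_mul, abs_of_nonneg (by linarith : 0 ≤ Real.sqrt t.2.1 + Real.sqrt t.2.2.1)]
      calc _ ≤ (δ * q) * (3 * q) := by gcongr; linarith
        _ = 3 * (δ * C) := by rw [← hq2]; ring
        _ < 1 := by linarith
    have e4 : |(t.2.1 : ℤ) - (t.2.2.1 : ℤ)| < 1 := by exact_mod_cast e3
    rw [Int.abs_lt_one_iff] at e4
    omega
  set m := min A D with hm
  set n := min B C with hn
  have hm1 : 1 ≤ m := le_min hA hD
  have hn1 : 1 ≤ n := le_min hB hC
  set T : Finset (ℕ × ℕ) := Finset.Icc 1 ⌊2 * m⌋₊ ×ˢ Finset.Icc 1 ⌊2 * n⌋₊ with hT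
  have hcard : F.card ≤ T.card := by
    apply Finset.card_le_card_of_injOn (fun t => (t.1, t.2.1))
    · intro t ht
      obtain ⟨h1, h2, h3, h4, h5, h6, h7, h8, h9⟩ := hF t ht
      have h10 := hbc t ht
      simp only [hT, Finset.coe_product, Set.mem_prod, Finset.mem_coe, Finset.mem_Icc]
      rw [← h7] at h4
      rw [← h10] at h3
      refine ⟨⟨h5, Nat.le_floor ?_⟩, ⟨h6, Nat.le_floor ?_⟩⟩
      · rw [hm, mul_min_of_nonneg _ _ (by norm_num)]; exact le_min h1 h4
      · rw [hn, mul_min_of_nonneg _ _ (by norm_num)]; exact le_min h2 h3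
    · intro p hp p' hp' h
      have a1 := hbc p hp
      have a2 := hbc p' hp'
      have a3 := (hF p hp).2.2.2.2.2.2.1
      have a4 := (hF p' hp').2.2.2.2.2.2.1
      obtain ⟨p1, p2, p3, p4⟩ := p
      obtain ⟨r1, r2, r3, r4⟩ := p'
      simp only [Prod.mk.injEq] at *
      omega
  have h1 : (⌊2 * m⌋₊ : ℝ) ≤ 2 * m := Nat.floor_le (by linarith)
  have h2 : (⌊2 * n⌋₊ : ℝ) ≤ 2 * n := Nat.floor_le (by linarith)
  have h3 : m * n ≤ Real.sqrt (A * B * C * D) := by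
    apply Real.le_sqrt_of_sq_le
    have e1 : m ^ 2 ≤ A * D := by
      rw [sq]; exact mul_le_mul (min_le_left _ _) (min_le_right _ _) (by linarith) (by linarith)
    have e2 : n ^ 2 ≤ B * C := by
      rw [sq]; exact mul_le_mul (min_le_left _ _) (min_le_right _ _) (by linarith) (by linarith)
    calc (m * n) ^ 2 = m ^ 2 * n ^ 2 := by ring
      _ ≤ (A * D) * (B * C) := by gcongr
      _ = _ := by ring
  calc (F.card : ℝ) ≤ T.card := by exact_mod_cast hcard
    _ = (⌊2 * m⌋₊ : ℝ) * ⌊2 * n⌋₊ := by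
      rw [hT, Finset.card_product]; simp
    _ ≤ (2 * m) * (2 * n) := by gcongr
    _ = 4 * (m * n) := by ring
    _ ≤ _ := by gcongr

theorem aux_first_off (ε : ℝ) (hε : 0 < ε) : ∃ K : ℝ, 0 < K ∧
    ∀ A B C D δ : ℝ, 0 < δ → 1 ≤ A → A ≤ B → B ≤ C → 1 ≤ D → D ≤ C → δ * C ≤ 1 / 8 →
    ∀ F : Finset (ℕ × ℕ × ℕ × ℕ),
    (∀ t ∈ F, (t.1 : ℝ) ≤ 2 * A ∧ (t.2.1 : ℝ) ≤ 2 * B ∧ C < (t.2.2.1 : ℝ) ∧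
      (t.2.2.1 : ℝ) ≤ 2 * C ∧
      (t.2.2.2 : ℝ) ≤ 2 * D ∧ 1 ≤ t.1 ∧ 1 ≤ t.2.2.2 ∧ t.1 ≠ t.2.2.2 ∧
      |Real.sqrt t.1 + Real.sqrt t.2.1 - Real.sqrt t.2.2.1 - Real.sqrt t.2.2.2| ≤
        δ * Real.sqrt C) →
    (F.card : ℝ) ≤ K * (A * B * C * D * (δ + C ^ (-(3:ℝ)/2 + ε))) := by
  obtain ⟨K, hK, hpc⟩ := aux_pair_count ε hε
  refine ⟨64 * K, by positivity, ?_⟩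
  intro A B C D δ hδ hA hAB hBC hD hDC hδC F hF
  have hB : 1 ≤ B := by linarith
  have hC : 1 ≤ C := by linarith
  have hC0 : 0 < C := by linarith
  have hrhs : 0 ≤ 64 * K * (A * B * C * D * (δ + C ^ (-(3:ℝ)/2 + ε))) := by positivity
  rcases F.eq_empty_or_nonempty with hFe | ⟨t0, ht0⟩
  · rw [hFe]; simpa using hrhs
  set q : ℝ := Real.sqrt C with hq
  have hq2 : q ^ 2 = C := Real.sq_sqrt hC0.le
  have hq0 : 0 < q := Real.sqrt_pos.mpr hC0
  have hsq : ∀ n : ℕ, (n : ℝ) ≤ 2 * C → Real.sqrt n ≤ 3 / 2 * q := by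
    intro n hn
    apply Real.sqrt_le_iff.mpr
    constructor
    · positivity
    · calc (n : ℝ) ≤ 2 * C := hn
        _ ≤ 9 / 4 * q ^ 2 := by rw [hq2]; linarith
        _ = _ := by ring
  have hBC16 : C ≤ 16 * B := by
    obtain ⟨h1, h2, h3, h4, h5, h6, h7, h8, h9⟩ := hF t0 ht0
    have e1 : Real.sqrt t0.1 ≤ Real.sqrt (2 * B) := Real.sqrt_le_sqrt (by linarith)
    have e2 : Real.sqrt t0.2.1 ≤ Real.sqrt (2 * B) := Real.sqrt_le_sqrt h2
    have e3 : q ≤ Real.sqrt t0.2.2.1 := Real.sqrt_le_sqrt h3.le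
    have e4 := Real.sqrt_nonneg (t0.2.2.2 : ℝ)
    have e5 := (abs_le.mp h9).1
    have e6 : δ ≤ 1 / 8 := by
      calc δ = δ * 1 := by ring
        _ ≤ δ * C := by gcongr
        _ ≤ _ := hδC
    have e7 : δ * q ≤ 1 / 8 * q := by gcongr
    have e8 : 7 / 16 * q ≤ Real.sqrt (2 * B) := by linarith
    have e9 : (7 / 16 * q) ^ 2 ≤ 2 * B := by
      calc (7 / 16 * q) ^ 2 ≤ Real.sqrt (2 * B) ^ 2 := by gcongr
        _ = 2 * B := Real.sq_sqrt (by linarith)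
    have e10 : (7 / 16 * q) ^ 2 = 49 / 256 * C := by rw [← hq2]; ring
    linarith
  set T : Finset (ℕ × ℕ) := Finset.Icc 1 ⌊2 * A⌋₊ ×ˢ Finset.Icc 1 ⌊2 * D⌋₊ with hT
  have hTc : (T.card : ℝ) ≤ 4 * (A * D) := by
    have h1 : (⌊2 * A⌋₊ : ℝ) ≤ 2 * A := Nat.floor_le (by linarith)
    have h2 : (⌊2 * D⌋₊ : ℝ) ≤ 2 * D := Nat.floor_le (by linarith)
    calc (T.card : ℝ) = (⌊2 * A⌋₊ : ℝ) * ⌊2 * D⌋₊ := by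
          rw [hT, Finset.card_product]; simp
      _ ≤ (2 * A) * (2 * D) := by gcongr
      _ = _ := by ring
  have hcard := aux_card_fiber F T (fun x => (x.1, x.2.2.2)) (K * (δ * C ^ 2 + C ^ (1 / 2 + ε)))
    (by
      intro t ht
      obtain ⟨h1, h2, h3, h4, h5, h6, h7, h8, h9⟩ := hF t ht
      simp only [hT, Finset.mem_product, Finset.mem_Icc]
      exact ⟨⟨h6, Nat.le_floor h1⟩, ⟨h7, Nat.le_floor h5⟩⟩)
    (by
      rintro ⟨a, d⟩ -
      set G := F.filter (fun x => (x.1, x.2.2.2) = (a, d)) with hG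
      rcases G.eq_empty_or_nonempty with hGe | ⟨g, hg⟩
      · rw [hGe]
        have : 0 ≤ K * (δ * C ^ 2 + C ^ (1 / 2 + ε)) := by positivity
        simpa using this
      have hg1 := Finset.mem_filter.mp hg
      obtain ⟨h1, -, -, -, h5, h6, h7, h8, -⟩ := hF g hg1.1
      have hge := hg1.2
      simp only [Prod.mk.injEq] at hge
      rw [hge.1] at h1 h6 h8
      rw [hge.2] at h5 h7 h8
      have hinj : Set.InjOn (fun x : ℕ × ℕ × ℕ × ℕ => (x.2.1, x.2.2.1)) (G : Finset _) := by
        intro p hp p' hp' h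
        have e1 := (Finset.mem_filter.mp hp).2
        have e2 := (Finset.mem_filter.mp hp').2
        obtain ⟨p1, p2, p3, p4⟩ := p
        obtain ⟨r1, r2, r3, r4⟩ := p'
        simp only [Prod.mk.injEq] at *
        omega
      rw [← Finset.card_image_of_injOn hinj]
      have sa := hsq a (by linarith)
      have sd := hsq d (by linarith)
      have sa0 := Real.sqrt_nonneg (a : ℝ)
      have sd0 := Real.sqrt_nonneg (d : ℝ)
      have sa2 : Real.sqrt a ^ 2 = a := Real.sq_sqrt (Nat.cast_nonneg _)
      have sd2 : Real.sqrt d ^ 2 = d := Real.sq_sqrt (Nat.cast_nonneg _)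
      apply hpc C δ (Real.sqrt d - Real.sqrt a) hC hδ hδC
      · have e0 : (1 : ℤ) ≤ |(d : ℤ) - a| := by
          apply Int.one_le_abs
          omega
        have e1 : (1 : ℝ) ≤ |(d : ℝ) - a| := by exact_mod_cast e0
        rw [← sa2, ← sd2] at e1
        have e2 : Real.sqrt d ^ 2 - Real.sqrt a ^ 2
          = (Real.sqrt d - Real.sqrt a) * (Real.sqrt d + Real.sqrt a) := by ring
        rw [e2, abs_mul, abs_of_nonneg (by linarith : 0 ≤ Real.sqrt d + Real.sqrt a)] at e1
        have e3 : |Real.sqrt d - Real.sqrt a| * (Real.sqrt d + Real.sqrt a)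
          ≤ |Real.sqrt d - Real.sqrt a| * (3 * q) := by gcongr; linarith
        linarith
      · rw [abs_le]
        constructor <;> linarith
      · intro p hp
        rw [Finset.mem_image] at hp
        obtain ⟨x, hx, rfl⟩ := hp
        have hx1 := Finset.mem_filter.mp hx
        obtain ⟨-, g2, -, g4, -, -, -, -, g9⟩ := hF x hx1.1
        have e := hx1.2
        simp only [Prod.mk.injEq] at e
        refine ⟨?_, g4, ?_⟩
        · simp only []
          linarith
        · rw [e.1, e.2] at g9
          refine le_trans (le_of_eq ?_) g9
          congr 1
          simp only []
          ring)
  have hpow : C ^ (1 / 2 + ε) = C ^ 2 * C ^ (-(3:ℝ)/2 + ε) := by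
    rw [← Real.rpow_natCast, ← Real.rpow_add hC0]
    congr 1
    push_cast
    ring
  rw [hpow] at hcard
  have hX : 0 < δ + C ^ (-(3:ℝ)/2 + ε) := by positivity
  calc (F.card : ℝ) ≤ K * (δ * C ^ 2 + C ^ 2 * C ^ (-(3:ℝ)/2 + ε)) * T.card := hcard
    _ ≤ K * (δ * C ^ 2 + C ^ 2 * C ^ (-(3:ℝ)/2 + ε)) * (4 * (A * D)) := by gcongr
    _ = 4 * K * (A * D * C * (δ + C ^ (-(3:ℝ)/2 + ε))) * C := by ring
    _ ≤ 4 * K * (A * D * C * (δ + C ^ (-(3:ℝ)/2 + ε))) * (16 * B) := by gcongr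
    _ = _ := by ring

/-- The conditions in the theorem. -/
def aux_cond (A B C D δ : ℝ) (t : ℕ × ℕ × ℕ × ℕ) : Prop :=
  A < t.1 ∧ (t.1 : ℝ) ≤ 2 * A ∧ B < t.2.1 ∧ (t.2.1 : ℝ) ≤ 2 * B ∧
    C < t.2.2.1 ∧ (t.2.2.1 : ℝ) ≤ 2 * C ∧ D < t.2.2.2 ∧ (t.2.2.2 : ℝ) ≤ 2 * D ∧
    |Real.sqrt t.1 + Real.sqrt t.2.1 - Real.sqrt t.2.2.1 - Real.sqrt t.2.2.2| ≤
      δ * Real.sqrt C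

theorem aux_first0 (ε : ℝ) (hε : 0 < ε) : ∃ K : ℝ, 0 < K ∧
    ∀ A B C D δ : ℝ, 0 < δ → 1 ≤ A → A ≤ B → B ≤ C → 1 ≤ D → D ≤ C →
    ∀ F : Finset (ℕ × ℕ × ℕ × ℕ), (∀ t ∈ F, aux_cond A B C D δ t) →
    (F.card : ℝ) ≤ K * (A * B * C * D * (δ + C ^ (-(3:ℝ)/2 + ε)) +
      (A * B * C * D) ^ ((1:ℝ)/2)) := by
  obtain ⟨K, hK, hoff⟩ := aux_first_off ε hε
  refine ⟨K + 112, by positivity, ?_⟩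
  intro A B C D δ hδ hA hAB hBC hD hDC F hF
  have hB : 1 ≤ B := by linarith
  have hC : 1 ≤ C := by linarith
  have hC0 : 0 < C := by linarith
  have hone : ∀ (n : ℕ) (X : ℝ), 1 ≤ X → X < n → 1 ≤ n := by
    intro n X h1 h2
    have : (1 : ℝ) < n := by linarith
    have : 1 < n := by exact_mod_cast this
    omega
  rw [← Real.sqrt_eq_rpow]
  have hs : 0 ≤ Real.sqrt (A * B * C * D) := Real.sqrt_nonneg _
  have hP : 0 ≤ A * B * C * D := by positivity
  have hR : 0 ≤ C ^ (-(3:ℝ)/2 + ε) := by positivity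
  have hPR : 0 ≤ A * B * C * D * (δ + C ^ (-(3:ℝ)/2 + ε)) := by positivity
  have hKs : 0 ≤ K * Real.sqrt (A * B * C * D) := by positivity
  have hKP : 0 ≤ K * (A * B * C * D * (δ + C ^ (-(3:ℝ)/2 + ε))) := by positivity
  by_cases hδC : δ * C ≤ 1 / 8
  · have hsplit := Finset.card_filter_add_card_filter_not (s := F) (fun t => t.1 = t.2.2.2)
    have h1 := aux_first_diag A B C D δ hδ hA hB hC hD hδC (F.filter (fun t => t.1 = t.2.2.2)) (by
      intro t ht
      rw [Finset.mem_filter] at ht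
      obtain ⟨a1, a2, b1, b2, c1, c2, d1, d2, e⟩ := hF t ht.1
      exact ⟨a2, b2, c2, d2, hone _ _ hA a1, hone _ _ hB b1, ht.2, hBC, e⟩)
    have h2 := hoff A B C D δ hδ hA hAB hBC hD hDC hδC (F.filter (fun t => ¬ t.1 = t.2.2.2)) (by
      intro t ht
      rw [Finset.mem_filter] at ht
      obtain ⟨a1, a2, b1, b2, c1, c2, d1, d2, e⟩ := hF t ht.1
      exact ⟨a2, b2, c1, c2, d2, hone _ _ hA a1, hone _ _ hD d1, ht.2, e⟩)
    have h3 : (F.card : ℝ) = (F.filter (fun t => t.1 = t.2.2.2)).card +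
        (F.filter (fun t => ¬ t.1 = t.2.2.2)).card := by exact_mod_cast hsplit.symm
    rw [h3]
    linarith
  · have h1 := aux_first_large A B C D δ hδ hA hB hC hD (not_le.mp hδC) F (by
      intro t ht
      obtain ⟨a1, a2, b1, b2, c1, c2, d1, d2, e⟩ := hF t ht
      exact ⟨a2, b2, c2, d2, hone _ _ hA a1, hone _ _ hB b1, hone _ _ hD d1, e⟩)
    have h2 : 0 ≤ A * B * C * D * C ^ (-(3:ℝ)/2 + ε) := by positivity
    have h3 : A * B * C * D * (δ + C ^ (-(3:ℝ)/2 + ε)) =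
      A * B * C * D * δ + A * B * C * D * C ^ (-(3:ℝ)/2 + ε) := by ring
    linarith

theorem aux_first (ε : ℝ) (hε : 0 < ε) : ∃ K : ℝ, 0 < K ∧
    ∀ A B C D δ : ℝ, 0 < δ → 1 ≤ A → A ≤ C → 1 ≤ B → B ≤ C → 1 ≤ D → D ≤ C →
    ∀ F : Finset (ℕ × ℕ × ℕ × ℕ), (∀ t ∈ F, aux_cond A B C D δ t) →
    (F.card : ℝ) ≤ K * (A * B * C * D * (δ + C ^ (-(3:ℝ)/2 + ε)) +
      (A * B * C * D) ^ ((1:ℝ)/2)) := by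
  obtain ⟨K, hK, h0⟩ := aux_first0 ε hε
  refine ⟨K, hK, ?_⟩
  intro A B C D δ hδ hA hAC hB hBC hD hDC F hF
  rcases le_total A B with h | h
  · exact h0 A B C D δ hδ hA h hBC hD hDC F hF
  · have hinj : Function.Injective
        (fun t : ℕ × ℕ × ℕ × ℕ => ((t.2.1, t.1, t.2.2.1, t.2.2.2) : ℕ × ℕ × ℕ × ℕ)) := by
      rintro ⟨p1, p2, p3, p4⟩ ⟨r1, r2, r3, r4⟩ h
      simp only [Prod.mk.injEq] at *
      omega
    have h1 := h0 B A C D δ hδ hB h hAC hD hDC (F.image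
      (fun t : ℕ × ℕ × ℕ × ℕ => ((t.2.1, t.1, t.2.2.1, t.2.2.2) : ℕ × ℕ × ℕ × ℕ))) (by
        intro t ht
        rw [Finset.mem_image] at ht
        obtain ⟨x, hx, rfl⟩ := ht
        obtain ⟨a1, a2, b1, b2, c1, c2, d1, d2, e⟩ := hF x hx
        refine ⟨b1, b2, a1, a2, c1, c2, d1, d2, ?_⟩
        rw [add_comm (Real.sqrt _)]
        exact e)
    rw [Finset.card_image_of_injective _ hinj, mul_comm B A] at h1
    exact h1

/-- An integer close to eight times the square root of the product. -/
def aux_X (t : ℕ × ℕ × ℕ × ℕ) : ℤ :=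
  4 * t.1 * t.2.1 + 4 * t.2.2.1 * t.2.2.2 - ((t.1 : ℤ) + t.2.1 - t.2.2.1 - t.2.2.2) ^ 2

theorem aux_X_bound (α β γ κ q δ : ℝ) (hq : 0 < q)
    (ha0 : 0 ≤ α) (ha : α ^ 2 ≤ 2 * q ^ 2) (hb0 : 0 ≤ β) (hb : β ^ 2 ≤ 2 * q ^ 2)
    (hc0 : 0 ≤ γ) (hc : γ ^ 2 ≤ 2 * q ^ 2) (hd0 : 0 ≤ κ) (hd : κ ^ 2 ≤ 2 * q ^ 2)
    (h : |α + β - γ - κ| ≤ δ * q) :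
    |(4 * α ^ 2 * β ^ 2 + 4 * γ ^ 2 * κ ^ 2 - (α ^ 2 + β ^ 2 - γ ^ 2 - κ ^ 2) ^ 2)
      - 8 * (α * β * γ * κ)| ≤ 12 * (δ * q ^ 4) := by
  have hle : ∀ z : ℝ, 0 ≤ z → z ^ 2 ≤ 2 * q ^ 2 → z ≤ 3 / 2 * q := by
    intro z _ h2
    apply le_of_sq_le_sq _ (by positivity)
    calc z ^ 2 ≤ 2 * q ^ 2 := h2
      _ ≤ 9 / 4 * q ^ 2 := by gcongr; norm_num
      _ = _ := by ring
  have a3 := hle α ha0 ha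
  have b3 := hle β hb0 hb
  have c3 := hle γ hc0 hc
  have d3 := hle κ hd0 hd
  have e : (4 * α ^ 2 * β ^ 2 + 4 * γ ^ 2 * κ ^ 2 - (α ^ 2 + β ^ 2 - γ ^ 2 - κ ^ 2) ^ 2)
      - 8 * (α * β * γ * κ) = (α + β - γ - κ) * (α + β + γ + κ) *
        ((γ - κ) ^ 2 - (α - β) ^ 2) := by ring
  have hsqd : ∀ x y : ℝ, 0 ≤ x → x ^ 2 ≤ 2 * q ^ 2 → 0 ≤ y → y ^ 2 ≤ 2 * q ^ 2 →
      (x - y) ^ 2 ≤ 2 * q ^ 2 := by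
    intro x y hx hx2 hy hy2
    rcases le_total x y with hxy | hxy
    · nlinarith [mul_nonneg hx (sub_nonneg.mpr hxy), mul_nonneg hx hy]
    · nlinarith [mul_nonneg hy (sub_nonneg.mpr hxy), mul_nonneg hx hy]
  have e1 := hsqd α β ha0 ha hb0 hb
  have e2 := hsqd γ κ hc0 hc hd0 hd
  have e3 : |(γ - κ) ^ 2 - (α - β) ^ 2| ≤ 2 * q ^ 2 := by
    rw [abs_le]
    constructor <;> linarith [sq_nonneg (γ - κ), sq_nonneg (α - β)]
  rw [e, abs_mul, abs_mul, abs_of_nonneg (by linarith : 0 ≤ α + β + γ + κ)]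
  have hδ : 0 ≤ δ * q := le_trans (abs_nonneg _) h
  calc _ ≤ (δ * q) * (6 * q) * (2 * q ^ 2) := by gcongr; linarith
    _ = _ := by ring

theorem aux_prod_fiber (G : Finset (ℕ × ℕ × ℕ × ℕ)) (n : ℕ) (hn : 1 ≤ n)
    (hG : ∀ t ∈ G, t.1 * t.2.1 * t.2.2.1 * t.2.2.2 = n) :
    G.card ≤ n.divisors.card ^ 3 := by
  have : G.card ≤ (n.divisors ×ˢ n.divisors ×ˢ n.divisors).card := by
    apply Finset.card_le_card_of_injOn (fun t => (t.1, t.2.1, t.2.2.1))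
    · intro t ht
      have h := hG t ht
      simp only [Finset.coe_product, Set.mem_prod, Finset.mem_coe, Nat.mem_divisors]
      refine ⟨⟨⟨t.2.1 * t.2.2.1 * t.2.2.2, ?_⟩, by omega⟩,
        ⟨⟨t.1 * t.2.2.1 * t.2.2.2, ?_⟩, by omega⟩, ⟨⟨t.1 * t.2.1 * t.2.2.2, ?_⟩, by omega⟩⟩
      · rw [← h]; ring
      · rw [← h]; ring
      · rw [← h]; ring
    · intro p hp p' hp' h
      have h1 := hG p hp
      have h2 := hG p' hp'
      obtain ⟨p1, p2, p3, p4⟩ := p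
      obtain ⟨r1, r2, r3, r4⟩ := p'
      simp only [Prod.mk.injEq] at *
      obtain ⟨rfl, rfl, rfl⟩ := h
      refine ⟨rfl, rfl, rfl, ?_⟩
      have h3 : p1 * p2 * p3 * p4 = p1 * p2 * p3 * r4 := by rw [h1, h2]
      apply Nat.eq_of_mul_eq_mul_left _ h3
      rcases Nat.eq_zero_or_pos (p1 * p2 * p3) with h0 | h0
      · rw [h0] at h1; omega
      · exact h0
  refine this.trans (le_of_eq ?_)
  rw [Finset.card_product, Finset.card_product]
  ring

theorem aux_second (ε : ℝ) (hε : 0 < ε) : ∃ K : ℝ, 0 < K ∧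
    ∀ A B C D δ : ℝ, 0 < δ → 1 ≤ A → A ≤ C → 1 ≤ B → B ≤ C → 1 ≤ D → D ≤ C →
    ∀ F : Finset (ℕ × ℕ × ℕ × ℕ), (∀ t ∈ F, aux_cond A B C D δ t) →
    (F.card : ℝ) ≤ K * (A * B * C * D * (δ * C ^ (2:ℝ) + (A * B * C * D) ^ (-(1:ℝ)/2))
      * C ^ ε) := by
  obtain ⟨Kt, hKt1, hKt⟩ := aux_divisor_bound (ε / 12) (by positivity)
  set R : ℝ := (Kt * 16 ^ (ε / 12)) ^ 3 with hR
  have hR0 : 0 < R := by positivity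
  refine ⟨16 + 1368 * R, by positivity, ?_⟩
  intro A B C D δ hδ hA hAC hB hBC hD hDC F hF
  have hC : 1 ≤ C := by linarith
  have hC0 : 0 < C := by linarith
  have hone : ∀ (n : ℕ) (X : ℝ), 1 ≤ X → X < n → 1 ≤ n := by
    intro n X h1 h2
    have : (1 : ℝ) < n := by linarith
    have : 1 < n := by exact_mod_cast this
    omega
  set P : ℝ := A * B * C * D with hP
  have hP1 : 1 ≤ P := by
    rw [hP]
    exact one_le_mul_of_one_le_of_one_le (one_le_mul_of_one_le_of_one_le
      (one_le_mul_of_one_le_of_one_le hA hB) hC) hD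
  set Q : ℝ := Real.sqrt P with hQ
  have hQ2 : Q ^ 2 = P := Real.sq_sqrt (by linarith)
  have hQ1 : 1 ≤ Q := Real.one_le_sqrt.mpr hP1
  have hPinv : P * P ^ (-(1:ℝ)/2) = Q := by
    rw [hQ, Real.sqrt_eq_rpow]
    nth_rewrite 1 [← Real.rpow_one P]
    rw [← Real.rpow_add (by linarith)]
    congr 1
    ring
  have hCε : 1 ≤ C ^ ε := Real.one_le_rpow hC hε.le
  have hC2 : C ^ (2:ℝ) = C ^ 2 := by rw [← Real.rpow_natCast]; norm_num
  have hrhs : P * (δ * C ^ (2:ℝ) + P ^ (-(1:ℝ)/2)) * C ^ ε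
      = (Q ^ 2 * (δ * C ^ 2) + Q) * C ^ ε := by
    rw [mul_add, hPinv, hC2, hQ2]
  rw [hrhs]
  have hδC0 : 0 < δ * C ^ 2 := by positivity
  by_cases hcase : 1 ≤ δ * C ^ 2
  · set T : Finset (ℕ × ℕ × ℕ × ℕ) := Finset.Icc 1 ⌊2 * A⌋₊ ×ˢ Finset.Icc 1 ⌊2 * B⌋₊ ×ˢ
      Finset.Icc 1 ⌊2 * C⌋₊ ×ˢ Finset.Icc 1 ⌊2 * D⌋₊ with hT
    have hsub : F ⊆ T := by
      intro t ht
      obtain ⟨a1, a2, b1, b2, c1, c2, d1, d2, e⟩ := hF t ht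
      simp only [hT, Finset.mem_product, Finset.mem_Icc]
      exact ⟨⟨hone _ _ hA a1, Nat.le_floor a2⟩, ⟨hone _ _ hB b1, Nat.le_floor b2⟩,
        ⟨hone _ _ hC c1, Nat.le_floor c2⟩, ⟨hone _ _ hD d1, Nat.le_floor d2⟩⟩
    have hTc : (T.card : ℝ) ≤ 16 * Q ^ 2 := by
      have h1 : (⌊2 * A⌋₊ : ℝ) ≤ 2 * A := Nat.floor_le (by linarith)
      have h2 : (⌊2 * B⌋₊ : ℝ) ≤ 2 * B := Nat.floor_le (by linarith)
      have h3 : (⌊2 * C⌋₊ : ℝ) ≤ 2 * C := Nat.floor_le (by linarith)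
      have h4 : (⌊2 * D⌋₊ : ℝ) ≤ 2 * D := Nat.floor_le (by linarith)
      calc (T.card : ℝ) = (⌊2 * A⌋₊ : ℝ) * (⌊2 * B⌋₊ * (⌊2 * C⌋₊ * ⌊2 * D⌋₊)) := by
            rw [hT, Finset.card_product, Finset.card_product, Finset.card_product]; simp
        _ ≤ (2 * A) * ((2 * B) * ((2 * C) * (2 * D))) := by gcongr
        _ = 16 * P := by rw [hP]; ring
        _ = _ := by rw [hQ2]
    calc (F.card : ℝ) ≤ T.card := by exact_mod_cast Finset.card_le_card hsub
      _ ≤ 16 * Q ^ 2 := hTc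
      _ = 16 * ((Q ^ 2 * 1 + 0) * 1) := by ring
      _ ≤ (16 + 1368 * R) * ((Q ^ 2 * (δ * C ^ 2) + Q) * C ^ ε) := by
        gcongr
        · linarith
        · linarith
  · have hlt : δ * C ^ 2 < 1 := not_le.mp hcase
    set q : ℝ := Real.sqrt C with hq
    have hq2 : q ^ 2 = C := Real.sq_sqrt hC0.le
    have hq0 : 0 < q := Real.sqrt_pos.mpr hC0
    have hq4 : q ^ 4 = C ^ 2 := by rw [← hq2]; ring
    set ν : ℕ × ℕ × ℕ × ℕ → ℕ := fun t => t.1 * t.2.1 * t.2.2.1 * t.2.2.2 with hν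
    have hν1 : ∀ t ∈ F, 1 ≤ ν t := by
      intro t ht
      obtain ⟨a1, a2, b1, b2, c1, c2, d1, d2, e⟩ := hF t ht
      have h1 := hone _ _ hA a1
      have h2 := hone _ _ hB b1
      have h3 := hone _ _ hC c1
      have h4 := hone _ _ hD d1
      exact Nat.mul_pos (Nat.mul_pos (Nat.mul_pos h1 h2) h3) h4
    have hνP : ∀ t ∈ F, (ν t : ℝ) ≤ 16 * P := by
      intro t ht
      obtain ⟨a1, a2, b1, b2, c1, c2, d1, d2, e⟩ := hF t ht
      simp only [hν]
      push_cast
      calc (t.1 : ℝ) * t.2.1 * t.2.2.1 * t.2.2.2 ≤ (2 * A) * (2 * B) * (2 * C) * (2 * D) := by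
            gcongr
        _ = _ := by rw [hP]; ring
    have hνw : ∀ t ∈ F, Real.sqrt (ν t) ≤ 4 * Q := by
      intro t ht
      apply Real.sqrt_le_iff.mpr
      refine ⟨by positivity, (hνP t ht).trans (le_of_eq ?_)⟩
      rw [← hQ2]; ring
    have hX : ∀ t ∈ F, |(aux_X t : ℝ) - 8 * Real.sqrt (ν t)| ≤ 12 * (δ * C ^ 2) := by
      intro t ht
      obtain ⟨a1, a2, b1, b2, c1, c2, d1, d2, e⟩ := hF t ht
      have sa2 : Real.sqrt t.1 ^ 2 = t.1 := Real.sq_sqrt (Nat.cast_nonneg _)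
      have sb2 : Real.sqrt t.2.1 ^ 2 = t.2.1 := Real.sq_sqrt (Nat.cast_nonneg _)
      have sc2 : Real.sqrt t.2.2.1 ^ 2 = t.2.2.1 := Real.sq_sqrt (Nat.cast_nonneg _)
      have sd2 : Real.sqrt t.2.2.2 ^ 2 = t.2.2.2 := Real.sq_sqrt (Nat.cast_nonneg _)
      have h := aux_X_bound (Real.sqrt t.1) (Real.sqrt t.2.1) (Real.sqrt t.2.2.1)
        (Real.sqrt t.2.2.2) q δ hq0 (Real.sqrt_nonneg _) (by rw [sa2, hq2]; linarith)
        (Real.sqrt_nonneg _) (by rw [sb2, hq2]; linarith)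
        (Real.sqrt_nonneg _) (by rw [sc2, hq2]; linarith)
        (Real.sqrt_nonneg _) (by rw [sd2, hq2]; linarith) e
      rw [sa2, sb2, sc2, sd2, hq4] at h
      have hw : Real.sqrt (ν t) = Real.sqrt t.1 * Real.sqrt t.2.1 * Real.sqrt t.2.2.1
          * Real.sqrt t.2.2.2 := by
        simp only [hν]
        push_cast
        rw [Real.sqrt_mul (by positivity), Real.sqrt_mul (by positivity),
          Real.sqrt_mul (by positivity)]
      rw [hw]
      unfold aux_X
      push_cast
      exact h
    have hdivn : ∀ n : ℕ, 1 ≤ n → (n : ℝ) ≤ 16 * P → ((n.divisors.card ^ 3 : ℕ) : ℝ)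
        ≤ R * C ^ ε := by
      intro n hn1 hn2
      have hPC : P ≤ C ^ 4 := by
        calc P ≤ C * C * C * C := by rw [hP]; gcongr
          _ = _ := by ring
      have h1 : (n : ℝ) ^ (ε / 12) ≤ 16 ^ (ε / 12) * (C ^ 4) ^ (ε / 12) := by
        rw [← Real.mul_rpow (by norm_num) (by positivity)]
        apply Real.rpow_le_rpow (by positivity) _ (by positivity)
        linarith
      have h2 : ((C ^ 4) ^ (ε / 12)) ^ 3 = C ^ ε := by
        rw [← Real.rpow_natCast, ← Real.rpow_natCast, ← Real.rpow_mul hC0.le,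
          ← Real.rpow_mul hC0.le]
        congr 1
        push_cast
        ring
      push_cast
      calc (n.divisors.card : ℝ) ^ 3 ≤ (Kt * (16 ^ (ε / 12) * (C ^ 4) ^ (ε / 12))) ^ 3 := by
            gcongr
            exact (hKt n hn1).trans (by gcongr)
        _ = R * ((C ^ 4) ^ (ε / 12)) ^ 3 := by rw [hR]; ring
        _ = _ := by rw [h2]
    have hcard := aux_card_fiber F (Finset.Icc (-12 : ℤ) ⌊44 * Q⌋) aux_X
      ((R * C ^ ε) * (24 * (δ * C ^ 2) * Q + 1))
      (by
        intro t ht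
        have h1 := abs_le.mp (hX t ht)
        have h2 := hνw t ht
        have h3 := Real.sqrt_nonneg (ν t : ℝ)
        rw [Finset.mem_Icc]
        constructor
        · have : ((-12 : ℤ) : ℝ) ≤ aux_X t := by push_cast; linarith [h1.1]
          exact_mod_cast this
        · apply Int.le_floor.mpr
          linarith [h1.2])
      (by
        intro y _
        set G := F.filter (fun t => aux_X t = y) with hG
        have hc1 := aux_card_fiber G (G.image ν) ν (R * C ^ ε)
          (fun x hx => Finset.mem_image_of_mem _ hx)
          (by
            intro n hn
            rw [Finset.mem_image] at hn
            obtain ⟨x, hx, hxn⟩ := hn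
            have hxF := (Finset.mem_filter.mp hx).1
            have hn1 : 1 ≤ n := by rw [← hxn]; exact hν1 x hxF
            have hn2 : (n : ℝ) ≤ 16 * P := by rw [← hxn]; exact hνP x hxF
            refine le_trans ?_ (hdivn n hn1 hn2)
            have := aux_prod_fiber (G.filter (fun x => ν x = n)) n hn1 (by
              intro t ht
              exact (Finset.mem_filter.mp ht).2)
            exact_mod_cast this)
        refine hc1.trans ?_
        have hc2 := aux_card_diam (G.image ν) (24 * (δ * C ^ 2) * Q) (by positivity) (by
          intro n hn n' hn'
          rw [Finset.mem_image] at hn hn'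
          obtain ⟨x, hx, rfl⟩ := hn
          obtain ⟨x', hx', rfl⟩ := hn'
          rw [hG, Finset.mem_filter] at hx hx'
          have g1 := abs_le.mp (hX x hx.1)
          have g2 := abs_le.mp (hX x' hx'.1)
          rw [hx.2] at g1
          rw [hx'.2] at g2
          have w1 := hνw x hx.1
          have w2 := hνw x' hx'.1
          have v1 : Real.sqrt (ν x) ^ 2 = ν x := Real.sq_sqrt (Nat.cast_nonneg _)
          have v2 : Real.sqrt (ν x') ^ 2 = ν x' := Real.sq_sqrt (Nat.cast_nonneg _)
          have z1 := Real.sqrt_nonneg (ν x : ℝ)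
          have z2 := Real.sqrt_nonneg (ν x' : ℝ)
          have hd : Real.sqrt (ν x) - Real.sqrt (ν x') ≤ 3 * (δ * C ^ 2) := by
            linarith [g1.1, g2.2]
          rw [← v1, ← v2]
          calc Real.sqrt (ν x) ^ 2 - Real.sqrt (ν x') ^ 2
              = (Real.sqrt (ν x) - Real.sqrt (ν x')) * (Real.sqrt (ν x) + Real.sqrt (ν x')) := by
                ring
            _ ≤ (3 * (δ * C ^ 2)) * (Real.sqrt (ν x) + Real.sqrt (ν x')) := by gcongr
            _ ≤ (3 * (δ * C ^ 2)) * (8 * Q) := by gcongr; linarith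
            _ = _ := by ring)
        gcongr)
    have hI : ((Finset.Icc (-12 : ℤ) ⌊44 * Q⌋).card : ℝ) ≤ 57 * Q := by
      rw [Int.card_Icc]
      have h0 : 0 ≤ ⌊44 * Q⌋ := Int.floor_nonneg.mpr (by positivity)
      have h1 : ((⌊44 * Q⌋ + 1 - -12).toNat : ℤ) = ⌊44 * Q⌋ + 13 := by
        rw [Int.toNat_of_nonneg (by omega)]; ring
      have h2 : (((⌊44 * Q⌋ + 1 - -12).toNat : ℤ) : ℝ) = ⌊44 * Q⌋ + 13 := by
        rw [h1]; push_cast; ring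
      have h3 := Int.floor_le (44 * Q)
      rw [Int.cast_natCast] at h2
      rw [h2]
      linarith
    have hRC : 0 < R * C ^ ε := by positivity
    have hmain : (24 * (δ * C ^ 2) * Q + 1) * (57 * Q)
        ≤ 1368 * (Q ^ 2 * (δ * C ^ 2) + Q) := by
      have : (24 * (δ * C ^ 2) * Q + 1) * (57 * Q) = 1368 * (Q ^ 2 * (δ * C ^ 2)) + 57 * Q := by
        ring
      rw [this]
      linarith
    calc (F.card : ℝ) ≤ (R * C ^ ε) * (24 * (δ * C ^ 2) * Q + 1) *
          (Finset.Icc (-12 : ℤ) ⌊44 * Q⌋).card := hcard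
      _ ≤ (R * C ^ ε) * (24 * (δ * C ^ 2) * Q + 1) * (57 * Q) := by gcongr
      _ = (R * C ^ ε) * ((24 * (δ * C ^ 2) * Q + 1) * (57 * Q)) := by ring
      _ ≤ (R * C ^ ε) * (1368 * (Q ^ 2 * (δ * C ^ 2) + Q)) := by gcongr
      _ = (1368 * R) * ((Q ^ 2 * (δ * C ^ 2) + Q) * C ^ ε) := by ring
      _ ≤ _ := by
        gcongr
        linarith

theorem counting_two_two_quadruples :
    ∀ ε : ℝ, 0 < ε → ∃ K : ℝ, 0 < K ∧
      ∀ A B C D δ : ℝ, 0 < δ → 1 ≤ A → A ≤ C → 1 ≤ B → B ≤ C → 1 ≤ D → D ≤ C →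
        (Set.ncard {t : ℕ × ℕ × ℕ × ℕ |
            A < t.1 ∧ (t.1 : ℝ) ≤ 2 * A ∧ B < t.2.1 ∧ (t.2.1 : ℝ) ≤ 2 * B ∧
            C < t.2.2.1 ∧ (t.2.2.1 : ℝ) ≤ 2 * C ∧ D < t.2.2.2 ∧ (t.2.2.2 : ℝ) ≤ 2 * D ∧
            |Real.sqrt t.1 + Real.sqrt t.2.1 - Real.sqrt t.2.2.1 - Real.sqrt t.2.2.2| ≤
              δ * Real.sqrt C} : ℝ) ≤
          K * (A * B * C * D * (δ + C ^ (-(3:ℝ)/2 + ε)) + (A * B * C * D) ^ ((1:ℝ)/2)) ∧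
        (Set.ncard {t : ℕ × ℕ × ℕ × ℕ |
            A < t.1 ∧ (t.1 : ℝ) ≤ 2 * A ∧ B < t.2.1 ∧ (t.2.1 : ℝ) ≤ 2 * B ∧
            C < t.2.2.1 ∧ (t.2.2.1 : ℝ) ≤ 2 * C ∧ D < t.2.2.2 ∧ (t.2.2.2 : ℝ) ≤ 2 * D ∧
            |Real.sqrt t.1 + Real.sqrt t.2.1 - Real.sqrt t.2.2.1 - Real.sqrt t.2.2.2| ≤
              δ * Real.sqrt C} : ℝ) ≤
          K * (A * B * C * D * (δ * C ^ (2:ℝ) + (A * B * C * D) ^ (-(1:ℝ)/2)) * C ^ ε) := by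
  intro ε hε
  obtain ⟨K1, hK1, h1⟩ := aux_first ε hε
  obtain ⟨K2, hK2, h2⟩ := aux_second ε hε
  refine ⟨K1 + K2, by positivity, ?_⟩
  intro A B C D δ hδ hA hAC hB hBC hD hDC
  have hC : 1 ≤ C := by linarith
  have hfin : Set.Finite {t : ℕ × ℕ × ℕ × ℕ | aux_cond A B C D δ t} := by
    apply Set.Finite.subset (Finset.finite_toSet (Finset.Icc 0 ⌊2 * A⌋₊ ×ˢ
      Finset.Icc 0 ⌊2 * B⌋₊ ×ˢ Finset.Icc 0 ⌊2 * C⌋₊ ×ˢ Finset.Icc 0 ⌊2 * D⌋₊))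
    intro t ht
    obtain ⟨a1, a2, b1, b2, c1, c2, d1, d2, e⟩ := ht
    simp only [Finset.mem_coe, Finset.mem_product, Finset.mem_Icc]
    exact ⟨⟨Nat.zero_le _, Nat.le_floor a2⟩, ⟨Nat.zero_le _, Nat.le_floor b2⟩,
      ⟨Nat.zero_le _, Nat.le_floor c2⟩, ⟨Nat.zero_le _, Nat.le_floor d2⟩⟩
  have hcard : Set.ncard {t : ℕ × ℕ × ℕ × ℕ | aux_cond A B C D δ t} = hfin.toFinset.card :=
    Set.ncard_eq_toFinset_card _ hfin
  have hmem : ∀ t ∈ hfin.toFinset, aux_cond A B C D δ t := by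
    intro t ht
    exact (Set.Finite.mem_toFinset hfin).mp ht
  have g1 := h1 A B C D δ hδ hA hAC hB hBC hD hDC hfin.toFinset hmem
  have g2 := h2 A B C D δ hδ hA hAC hB hBC hD hDC hfin.toFinset hmem
  rw [← hcard] at g1 g2
  unfold aux_cond at g1 g2
  constructor
  · refine g1.trans ?_
    gcongr
    linarith
  · refine g2.trans ?_
    gcongr
    linarith
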